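/- arXiv:1606.04040 — 2 statements merged into one kernel-verified Lean document; each statement's English description precedes it below -/
import Mathlib

section
/- Let F_q be a finite field of odd characteristic, χ a nontrivial additive character, and η the quadratic character of F_q^*. For any natural number n, any a ∈ F_q^*, and any b ∈ F_q, the sum Σ_{s ∈ F_q^*} η(s)^n χ(as + b/s) has absolute value at most 2√q. -/
open Matrix Finset

open Polynomial in
/-- the multiplicative function on polynomials -/
noncomputable def klLam {F : Type*} [Field F] [DecidableEq F] (χ : AddChar F ℂ) (a b : F) (f : F[X]) : ℂ :=
  if f.coeff 0 = 0 then 0 else χ (-(a * f.nextCoeff) - b * f.coeff 1 / f.coeff 0)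

section LPart
open Polynomial
variable {F : Type*} [Field F] [DecidableEq F]

lemma klLam_mul (χ : AddChar F ℂ) (a b : F) {f g : F[X]} (hf : f.Monic) (hg : g.Monic) :
    klLam χ a b (f * g) = klLam χ a b f * klLam χ a b g := by
  unfold klLam
  rw [mul_coeff_zero, hf.nextCoeff_mul hg]
  by_cases h1 : f.coeff 0 = 0
  · simp [h1]
  by_cases h2 : g.coeff 0 = 0
  · simp [h2]
  rw [if_neg (mul_ne_zero h1 h2), if_neg h1, if_neg h2, ← AddChar.map_add_eq_mul]
  congr 1
  rw [mul_coeff_one]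
  field_simp
  ring

lemma klLam_one (χ : AddChar F ℂ) (a b : F) : klLam χ a b 1 = 1 := by
  simp [klLam, coeff_one, nextCoeff]

lemma klLam_pow (χ : AddChar F ℂ) (a b : F) {f : F[X]} (hf : f.Monic) (n : ℕ) :
    klLam χ a b (f ^ n) = klLam χ a b f ^ n := by
  induction n with
  | zero => simp [klLam_one]
  | succ n ih => rw [pow_succ, klLam_mul χ a b (hf.pow n) hf, ih, pow_succ]

variable [Fintype F]
lemma finite_monic (F : Type*) [Field F] [Fintype F] (d : ℕ) : {f : F[X] | f.Monic ∧ f.natDegree = d}.Finite := by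
  apply Set.Finite.of_finite_image (f := fun f : F[X] => fun i : Fin (d+1) => f.coeff i) (Set.toFinite _)
  rintro f ⟨hf, hf'⟩ g ⟨hg, hg'⟩ h
  ext i
  by_cases hi : i < d + 1
  · exact congrFun h ⟨i, hi⟩
  · rw [coeff_eq_zero_of_natDegree_lt (by omega), coeff_eq_zero_of_natDegree_lt (by omega)]

/-- monic polynomials of degree d -/
noncomputable def klMon (F : Type*) [Field F] [Fintype F] (d : ℕ) : Finset F[X] := (finite_monic F d).toFinset

lemma mem_klMon {d : ℕ} {f : F[X]} : f ∈ klMon F d ↔ f.Monic ∧ f.natDegree = d := by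
  simp [klMon]

open Classical in
/-- monic irreducible polynomials of degree d -/
noncomputable def klIrr (F : Type*) [Field F] [Fintype F] (d : ℕ) : Finset F[X] := (klMon F d).filter Irreducible

lemma mem_klIrr {d : ℕ} {f : F[X]} : f ∈ klIrr F d ↔ f.Monic ∧ f.natDegree = d ∧ Irreducible f := by
  simp [klIrr, mem_klMon, and_assoc]

/-- coefficients of the L-function -/
noncomputable def klC (χ : AddChar F ℂ) (a b : F) (d : ℕ) : ℂ := ∑ f ∈ klMon F d, klLam χ a b f

/-- prime power sums -/
noncomputable def klA (χ : AddChar F ℂ) (a b : F) (n : ℕ) : ℂ :=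
  ∑ x ∈ n.divisorsAntidiagonal, ∑ P ∈ klIrr F x.1, (x.1 : ℂ) * klLam χ a b P ^ x.2

lemma klC_zero (χ : AddChar F ℂ) (a b : F) : klC χ a b 0 = 1 := by
  have : klMon F 0 = {1} := by
    ext f; rw [mem_klMon, Finset.mem_singleton]
    constructor
    · rintro ⟨h, h'⟩; exact h.natDegree_eq_zero.mp h'
    · rintro rfl; simp
  simp [klC, this, klLam_one]

lemma exists_shift {χ : AddChar F ℂ} (hχ : χ ≠ 1) {a : F} (ha : a ≠ 0) : ∃ t, χ (-(a * t)) ≠ 1 := by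
  obtain ⟨x, hx⟩ := AddChar.ne_one_iff.mp hχ
  exact ⟨-(x / a), by rwa [show -(a * -(x/a)) = x by field_simp]⟩

lemma klC_ge_three {χ : AddChar F ℂ} (hχ : χ ≠ 1) {a : F} (ha : a ≠ 0) (b : F) {d : ℕ} (hd : 3 ≤ d) :
    klC χ a b d = 0 := by
  obtain ⟨t, ht⟩ := exists_shift hχ ha
  have key : klC χ a b d = χ (-(a * t)) * klC χ a b d := by
    have hmem : ∀ s : F, ∀ f ∈ klMon F d, f + C s * X ^ (d-1) ∈ klMon F d := by
      intro s f hf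
      rw [mem_klMon] at *
      have hlt : (C s * X ^ (d-1)).degree < f.degree := by
        rw [degree_eq_natDegree hf.1.ne_zero, hf.2]
        refine (degree_C_mul_X_pow_le _ _).trans_lt ?_
        exact_mod_cast (by omega : d - 1 < d)
      exact ⟨hf.1.add_of_left hlt, by rw [natDegree_add_eq_left_of_degree_lt hlt, hf.2]⟩
    conv_lhs => unfold klC
    unfold klC
    rw [Finset.mul_sum]
    symm
    refine Finset.sum_bij' (fun f _ => f + C t * X ^ (d-1)) (fun f _ => f + C (-t) * X ^ (d-1)) 
      (hmem t) (hmem (-t)) ?_ ?_ ?_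
    · intro f hf; simp
    · intro f hf; simp
    · intro f hf
      have h2 := (mem_klMon.mp (hmem t f hf)).2
      have h1 := (mem_klMon.mp hf).2
      unfold klLam
      rw [nextCoeff_of_natDegree_pos (by omega), nextCoeff_of_natDegree_pos (by omega), h1, h2]
      simp only [coeff_add, coeff_C_mul, coeff_X_pow]
      rw [if_neg (by omega : ¬ 0 = d - 1), if_neg (by omega : ¬ 1 = d - 1)]
      simp only [mul_zero, add_zero, if_true, mul_one]
      split_ifs
      · simp
      · rw [← AddChar.map_add_eq_mul]; congr 1; ring
  by_contra h
  exact ht (mul_right_cancel₀ h (by rw [one_mul]; exact key.symm))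

lemma klC_one (χ : AddChar F ℂ) (a b : F) : klC χ a b 1 = 
   ∑ s ∈ Finset.univ.filter (fun s : F => s ≠ 0), χ (a * s + b / s) := by
  rw [Finset.sum_filter]
  unfold klC
  symm
  refine Finset.sum_bij' (fun s _ => X - C s) (fun f _ => - f.coeff 0) ?_ ?_ ?_ ?_ ?_
  · intro s _; rw [mem_klMon]; exact ⟨monic_X_sub_C s, natDegree_X_sub_C s⟩
  · intro f _; simp
  · intro s _; simp
  · intro f hf
    rw [mem_klMon] at hf
    have := hf.1.eq_X_add_C hf.2
    conv_rhs => rw [this]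
    simp
  · intro s _
    unfold klLam
    simp only [coeff_sub, coeff_X_zero, coeff_C_zero, zero_sub, neg_eq_zero, nextCoeff_X_sub_C, coeff_X_one, coeff_C_succ, sub_zero]
    by_cases hs : s = 0
    · simp [hs]
    · simp only [hs, ne_eq, not_false_eq_true, if_true, if_false]; congr 1; field_simp; ring

lemma klC_two {χ : AddChar F ℂ} (hχ : χ ≠ 1) {a b : F} (ha : a ≠ 0) (hb : b ≠ 0)  :
    klC χ a b 2 = Fintype.card F := by
  have h1 : klC χ a b 2 = ∑ z : F × F, if z.2 = 0 then 0 else χ (-(a * z.1) - b * z.1 / z.2) := by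
    unfold klC
    refine Finset.sum_bij' (fun f _ => (f.coeff 1, f.coeff 0)) (fun z _ => X^2 + C z.1 * X + C z.2) ?_ ?_ ?_ ?_ ?_
    · simp
    · intro z _
      rw [mem_klMon]
      constructor
      · monicity!
      · compute_degree!
    · intro f hf
      rw [mem_klMon] at hf
      ext i
      match i with
      | 0 => simp
      | 1 => simp [coeff_X, coeff_C]
      | 2 => simp [coeff_X, coeff_C]; have := hf.1.coeff_natDegree; rw [hf.2] at this; exact this.symm
      | i+3 => 
        rw [coeff_eq_zero_of_natDegree_lt (p := f) (n := i + 3) (by rw [hf.2]; omega)]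
        simp [coeff_X, coeff_C, coeff_X_pow]
    · intro z _
      simp [coeff_X, coeff_C]
    · intro f hf
      rw [mem_klMon] at hf
      unfold klLam
      rw [nextCoeff_of_natDegree_pos (by omega), hf.2]
  rw [h1, Fintype.sum_prod_type_right]
  have h2 : ∀ v : F, (∑ u : F, if v = 0 then 0 else χ (-(a * u) - b * u / v)) = if v = -b/a then (Fintype.card F : ℂ) else 0 := by
    intro v
    by_cases hv : v = 0
    · have : v ≠ -b/a := by rw [hv]; exact (div_ne_zero (neg_ne_zero.mpr hb) ha).symm
      rw [if_neg this]; simp [hv]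
    · simp only [hv, if_false]
      have h3 : ∀ u, χ (-(a * u) - b * u / v) = χ (u * (-a - b/v)) := by
        intro u; congr 1; ring
      simp only [h3]
      rw [AddChar.sum_mulShift _ (AddChar.IsPrimitive.of_ne_one hχ)]
      have : -a - b/v = 0 ↔ v = -b/a := by
        field_simp
        constructor
        · intro h; linear_combination -h
        · intro h; linear_combination -h
      simp only [this]
      split_ifs <;> simp
  simp only [h2]
  simp
end LPart

section LPart2
open Polynomial
variable {F : Type*} [Field F] [DecidableEq F] [Fintype F]

open Classical in
lemma kl_mangoldt {d : ℕ} {f : F[X]} (hf : f ∈ klMon F d) :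
    (d : ℂ) = ∑ e ∈ Icc 1 d, ∑ P ∈ klIrr F e, ∑ j ∈ Icc 1 d, if P ^ j ∣ f then (e : ℂ) else 0 := by
  rw [mem_klMon] at hf
  obtain ⟨hm, hd⟩ := hf
  have hf0 := hm.ne_zero
  let s := UniqueFactorizationMonoid.normalizedFactors f
  have hprod : s.prod = f := by
    rw [UniqueFactorizationMonoid.prod_normalizedFactors_eq hf0, hm.normalize_eq_self]
  have hmem : ∀ P, P ∈ s ↔ Irreducible P ∧ P.Monic ∧ P ∣ f := fun P => Polynomial.mem_normalizedFactors_iff hf0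
  have hdeg : d = ∑ P ∈ s.toFinset, s.count P * P.natDegree := by
    rw [← hd, ← hprod, natDegree_multiset_prod_of_monic, Finset.sum_multiset_map_count]
    · simp [hprod]
    · intro P hP; exact ((hmem P).1 hP).2.1
  have hcount : ∀ P : F[X], P.Monic → Irreducible P → ∑ j ∈ Icc 1 d, (if P ^ j ∣ f then (P.natDegree : ℂ) else 0) = (s.count P * P.natDegree : ℕ) := by
    intro P hPm hPi
    rw [← Finset.sum_filter, Finset.sum_const, nsmul_eq_mul, Nat.cast_mul]
    congr 2
    have h1 : ∀ j, P ^ j ∣ f ↔ j ≤ s.count P := by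
      intro j
      rw [pow_dvd_iff_le_emultiplicity, UniqueFactorizationMonoid.emultiplicity_eq_count_normalizedFactors hPi hf0, hPm.normalize_eq_self]
      exact_mod_cast Iff.rfl
    have h2 : (Icc 1 d).filter (fun j => P ^ j ∣ f) = Icc 1 (s.count P) := by
      ext j
      rw [Finset.mem_filter, Finset.mem_Icc, Finset.mem_Icc, ← h1]
      constructor
      · rintro ⟨⟨h, _⟩, h'⟩; exact ⟨h, h'⟩
      · rintro ⟨h, h'⟩; refine ⟨⟨h, ?_⟩, h'⟩
        have := natDegree_le_of_dvd h' hf0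
        rw [natDegree_pow, hd] at this
        have := hPi.natDegree_pos
        nlinarith
    rw [h2]; simp
  have h3 : ∀ e ∈ Icc 1 d, ∀ P ∈ klIrr F e, (∑ j ∈ Icc 1 d, if P ^ j ∣ f then (e : ℂ) else 0) = (s.count P * P.natDegree : ℕ) := by
    intro e he P hP
    rw [mem_klIrr] at hP
    rw [← hcount P hP.1 hP.2.2, hP.2.1]
  rw [Finset.sum_congr rfl (fun e he => Finset.sum_congr rfl (h3 e he))]
  conv_lhs => rw [hdeg]
  push_cast
  rw [Finset.sum_sigma']
  symm
  have h4 : ∑ x ∈ (Icc 1 d).sigma (fun e => klIrr F e), ((s.count x.2 : ℂ) * (x.2.natDegree : ℂ)) =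
     ∑ x ∈ ((Icc 1 d).sigma (fun e => klIrr F e)).filter (fun x => x.2 ∈ s), ((s.count x.2 : ℂ) * (x.2.natDegree : ℂ)) := by
    rw [Finset.sum_filter]
    apply Finset.sum_congr rfl
    intro x _
    split_ifs with h
    · rfl
    · rw [Multiset.count_eq_zero_of_notMem h]; simp
  rw [h4]
  refine Finset.sum_bij' (fun x _ => x.2) (fun P _ => ⟨P.natDegree, P⟩) ?_ ?_ ?_ ?_ ?_
  · intro x hx; simp at hx; simpa using hx.2
  · intro P hP
    rw [Multiset.mem_toFinset] at hP
    have := (hmem P).1 hP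
    simp only [Finset.mem_filter, Finset.mem_sigma, Finset.mem_Icc, mem_klIrr]
    exact ⟨⟨⟨this.1.natDegree_pos, hd ▸ natDegree_le_of_dvd this.2.2 hf0⟩, this.2.1, trivial, this.1⟩, hP⟩
  · rintro ⟨e, P⟩ hx
    simp only [Finset.mem_filter, Finset.mem_sigma, Finset.mem_Icc, mem_klIrr] at hx
    obtain ⟨⟨_, _, rfl, _⟩, _⟩ := hx
    rfl
  · intros; rfl
  · intros; rfl

open Classical in
lemma kl_inner (χ : AddChar F ℂ) (a b : F) (d e j : ℕ) {P : F[X]} (hP : P ∈ klIrr F e) :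
    (∑ f ∈ klMon F d, if P ^ j ∣ f then klLam χ a b f else 0) =
      if e * j ≤ d then klLam χ a b P ^ j * klC χ a b (d - e * j) else 0 := by
  rw [mem_klIrr] at hP
  obtain ⟨hm, he, hi⟩ := hP
  rw [← Finset.sum_filter]
  have hmj := hm.pow j
  have hdj : (P ^ j).natDegree = e * j := by rw [natDegree_pow, he, mul_comm]
  split_ifs with h
  · unfold klC
    rw [Finset.mul_sum]
    symm
    refine Finset.sum_bij (fun g _ => P ^ j * g) ?_ ?_ ?_ ?_
    · intro g hg
      rw [mem_klMon] at hg
      rw [Finset.mem_filter, mem_klMon]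
      refine ⟨⟨hmj.mul hg.1, ?_⟩, dvd_mul_right _ _⟩
      rw [hmj.natDegree_mul hg.1, hdj, hg.2]; omega
    · intro g _ g' _ h; exact mul_left_cancel₀ hmj.ne_zero h
    · intro f hf
      rw [Finset.mem_filter, mem_klMon] at hf
      obtain ⟨⟨hfm, hfd⟩, g, rfl⟩ := hf
      have hg := hmj.of_mul_monic_left hfm
      refine ⟨g, ?_, rfl⟩
      rw [mem_klMon]
      refine ⟨hg, ?_⟩
      rw [hmj.natDegree_mul hg, hdj] at hfd; omega
    · intro g hg
      rw [mem_klMon] at hg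
      rw [klLam_mul χ a b hmj hg.1, klLam_pow χ a b hm]
  · apply Finset.sum_eq_zero
    intro f hf
    rw [Finset.mem_filter, mem_klMon] at hf
    have := natDegree_le_of_dvd hf.2 hf.1.1.ne_zero
    rw [hdj, hf.1.2] at this
    exact absurd this h

lemma kl_newton (χ : AddChar F ℂ) (a b : F) (d : ℕ) :
    (d : ℂ) * klC χ a b d = ∑ n ∈ Icc 1 d, klA χ a b n * klC χ a b (d - n) := by
  classical
  have h1 : (d : ℂ) * klC χ a b d = ∑ e ∈ Icc 1 d, ∑ P ∈ klIrr F e, ∑ j ∈ Icc 1 d, 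
      if e * j ≤ d then (e : ℂ) * (klLam χ a b P ^ j * klC χ a b (d - e * j)) else 0 := by
    conv_lhs => unfold klC
    rw [Finset.mul_sum]
    rw [Finset.sum_congr rfl (fun f hf => by rw [kl_mangoldt hf])]
    simp only [Finset.sum_mul]
    rw [Finset.sum_comm]
    refine Finset.sum_congr rfl fun e _ => ?_
    rw [Finset.sum_comm]
    refine Finset.sum_congr rfl fun P hP => ?_
    rw [Finset.sum_comm]
    refine Finset.sum_congr rfl fun j _ => ?_
    rw [← mul_ite_zero, ← kl_inner χ a b d e j hP, Finset.mul_sum]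
    refine Finset.sum_congr rfl fun f _ => ?_
    split_ifs <;> simp
  rw [h1]
  let G : ℕ → ℕ → ℂ := fun e j => (∑ P ∈ klIrr F e, (e : ℂ) * klLam χ a b P ^ j)
  have h2 : ∀ e ∈ Icc 1 d, (∑ P ∈ klIrr F e, ∑ j ∈ Icc 1 d, 
      if e * j ≤ d then (e : ℂ) * (klLam χ a b P ^ j * klC χ a b (d - e * j)) else 0) = 
      ∑ j ∈ Icc 1 d, if e * j ≤ d then G e j * klC χ a b (d - e * j) else 0 := by
    intro e _
    rw [Finset.sum_comm]
    refine Finset.sum_congr rfl fun j _ => ?_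
    split_ifs
    · simp only [G]; rw [Finset.sum_mul]; refine Finset.sum_congr rfl fun P _ => ?_; ring
    · simp
  rw [Finset.sum_congr rfl h2, Finset.sum_sigma', ← Finset.sum_filter]
  have h3 : ∀ n, klA χ a b n * klC χ a b (d - n) = ∑ x ∈ n.divisorsAntidiagonal, G x.1 x.2 * klC χ a b (d - n) := by
    intro n; rw [← Finset.sum_mul]; rfl
  simp only [h3]
  rw [Finset.sum_sigma']
  refine Finset.sum_bij' (fun x _ => ⟨x.1 * x.2, (x.1, x.2)⟩) (fun y _ => ⟨y.2.1, y.2.2⟩) ?_ ?_ ?_ ?_ ?_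
  · rintro ⟨e, j⟩ h
    simp only [Finset.mem_filter, Finset.mem_sigma, Finset.mem_Icc, Nat.mem_divisorsAntidiagonal] at h ⊢
    obtain ⟨⟨⟨h1, h2⟩, h3, h4⟩, h5⟩ := h
    have : 0 < e * j := Nat.mul_pos h1 h3
    exact ⟨⟨this, h5⟩, trivial, this.ne'⟩
  · rintro ⟨n, e, j⟩ h
    simp only [Finset.mem_filter, Finset.mem_sigma, Finset.mem_Icc, Nat.mem_divisorsAntidiagonal] at h ⊢
    obtain ⟨⟨h1, h2⟩, rfl, h0⟩ := h
    have he : 0 < e := Nat.pos_of_ne_zero (by rintro rfl; simp at h0)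
    have hj : 0 < j := Nat.pos_of_ne_zero (by rintro rfl; simp at h0)
    refine ⟨⟨⟨he, ?_⟩, hj, ?_⟩, h2⟩ <;> nlinarith
  · intros; rfl
  · rintro ⟨n, e, j⟩ h
    simp only [Finset.mem_filter, Finset.mem_sigma, Finset.mem_Icc, Nat.mem_divisorsAntidiagonal] at h ⊢
    obtain ⟨⟨h1, h2⟩, rfl, h0⟩ := h
    rfl
  · intros; rfl
end LPart2

section LPart3
open Polynomial IntermediateField
variable {F : Type*} [Field F] [DecidableEq F] [Fintype F]
variable {E : Type*} [Field E] [Fintype E] [DecidableEq E] [Algebra F E]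

lemma kl_minpoly_inv (x : E) (hx : x ≠ 0) :
    (minpoly F x⁻¹).natDegree = (minpoly F x).natDegree ∧ 
    (minpoly F x⁻¹).nextCoeff = (minpoly F x).coeff 1 / (minpoly F x).coeff 0 := by
  have hIn : IsIntegral F x := .of_finite F x
  have hIn' : IsIntegral F x⁻¹ := .of_finite F x⁻¹
  have hadj : F⟮x⁻¹⟯ = F⟮x⟯ := by
    apply le_antisymm
    · rw [adjoin_simple_le_iff]; exact inv_mem (mem_adjoin_simple_self F x)
    · rw [adjoin_simple_le_iff]; simpa using inv_mem (mem_adjoin_simple_self F x⁻¹)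
  have hdeg : (minpoly F x⁻¹).natDegree = (minpoly F x).natDegree := by
    rw [← adjoin.finrank hIn, ← adjoin.finrank hIn', hadj]
  refine ⟨hdeg, ?_⟩
  set P := minpoly F x with hP
  have hP0 : P.coeff 0 ≠ 0 := minpoly.coeff_zero_ne_zero hIn hx
  have hPm : P.Monic := minpoly.monic hIn
  have htr : P.natTrailingDegree = 0 := natTrailingDegree_eq_zero.mpr (Or.inr hP0)
  have hrd : P.reverse.natDegree = P.natDegree := by rw [reverse_natDegree, htr]; simp
  have hPpos : 0 < P.natDegree := minpoly.natDegree_pos hIn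
  let Q := C (P.coeff 0)⁻¹ * P.reverse
  have hQd : Q.natDegree = P.natDegree := by
    rw [← hrd]; exact natDegree_C_mul (inv_ne_zero hP0)
  have hQm : Q.Monic := by
    have : P.reverse.leadingCoeff = P.coeff 0 := by
      rw [reverse_leadingCoeff, trailingCoeff, htr]
    rw [Monic, leadingCoeff_mul, this, leadingCoeff_C, inv_mul_cancel₀ hP0]
  have hQe : aeval x⁻¹ Q = 0 := by
    rw [map_mul]
    have : aeval x⁻¹ P.reverse = 0 := by
      letI := invertibleOfNonzero hx
      have := (eval₂_reverse_eq_zero_iff (algebraMap F E) x P).mpr (minpoly.aeval F x)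
      rw [invOf_eq_inv] at this
      exact this
    rw [this, mul_zero]
  have hQ : Q = minpoly F x⁻¹ := by
    apply minpoly.unique_of_degree_le_degree_minpoly _ _ hQm hQe
    rw [degree_eq_natDegree hQm.ne_zero, degree_eq_natDegree (minpoly.ne_zero hIn'), hQd, hdeg]
  rw [← hQ, nextCoeff_of_natDegree_pos (by omega), hQd, coeff_C_mul, coeff_reverse, revAt_le (by omega)]
  rw [show P.natDegree - (P.natDegree - 1) = 1 by omega]
  field_simp

lemma kl_char_eq (χ : AddChar F ℂ) (a b : F) (x : E) (hx : x ≠ 0) :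
    χ (Algebra.trace F E (algebraMap F E a * x + algebraMap F E b / x)) = 
     klLam χ a b (minpoly F x) ^ (Module.finrank F E / (minpoly F x).natDegree) := by
  have hIn : IsIntegral F x := .of_finite F x
  have hIn' : IsIntegral F x⁻¹ := .of_finite F x⁻¹
  have hP0 : (minpoly F x).coeff 0 ≠ 0 := minpoly.coeff_zero_ne_zero hIn hx
  obtain ⟨h1, h2⟩ := kl_minpoly_inv (F := F) x hx
  have hfr : ∀ y : E, IsIntegral F y → Module.finrank F⟮y⟯ E = Module.finrank F E / (minpoly F y).natDegree := by
    intro y hy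
    rw [← Module.finrank_mul_finrank F F⟮y⟯ E, adjoin.finrank hy, Nat.mul_div_cancel_left _ (minpoly.natDegree_pos hy)]
  rw [klLam, if_neg hP0, ← AddChar.map_nsmul_eq_pow, div_eq_mul_inv, ← Algebra.smul_def, ← Algebra.smul_def, map_add, map_smul, map_smul,
    trace_eq_finrank_mul_minpoly_nextCoeff, trace_eq_finrank_mul_minpoly_nextCoeff, hfr x hIn, hfr _ hIn', h1, h2]
  congr 1
  rw [nsmul_eq_mul, smul_eq_mul, smul_eq_mul]
  ring

lemma kl_card_fiber {P : F[X]} (hm : P.Monic) (hi : Irreducible P) (hd : P.natDegree ∣ Module.finrank F E) :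
    (Finset.univ.filter (fun x : E => minpoly F x = P)).card = P.natDegree := by
  have hsplit : (P.map (algebraMap F E)).Splits := by
    have h := (hi.natDegree_dvd_iff_dvd_X_pow_card_pow_sub_X).mp hd
    rw [← Module.natCard_eq_pow_finrank, Nat.card_eq_fintype_card] at h
    have := FiniteField.isSplittingField_sub E F
    refine Splits.of_dvd (this.splits) ?_ (map_dvd (algebraMap F E) h)
    rw [Polynomial.map_sub, Polynomial.map_pow, map_X]
    exact FiniteField.X_pow_card_sub_X_ne_zero E Fintype.one_lt_card
  rw [← card_rootSet_eq_natDegree (K := E) (PerfectField.separable_of_irreducible hi) hsplit, ← Set.toFinset_card]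
  congr 1
  ext x
  simp only [Finset.mem_filter, Finset.mem_univ, true_and, Set.mem_toFinset]
  rw [mem_rootSet]
  constructor
  · rintro rfl; exact ⟨hm.ne_zero, minpoly.aeval F x⟩
  · rintro ⟨_, h⟩; exact (minpoly.eq_of_irreducible_of_monic hi h hm).symm

lemma kl_sum_eq (χ : AddChar F ℂ) (a b : F) :
    ∑ x ∈ Finset.univ.filter (fun x : E => x ≠ 0), χ (Algebra.trace F E (algebraMap F E a * x + algebraMap F E b / x)) 
     = klA χ a b (Module.finrank F E) := by
  classical
  set n := Module.finrank F E with hn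
  have hnpos : 0 < n := Module.finrank_pos
  have hdvd : ∀ x : E, (minpoly F x).natDegree ∣ n := fun x => minpoly.degree_dvd (.of_finite F x)
  have h1 : ∑ x ∈ Finset.univ.filter (fun x : E => x ≠ 0), χ (Algebra.trace F E (algebraMap F E a * x + algebraMap F E b / x)) 
     = ∑ x : E, klLam χ a b (minpoly F x) ^ (n / (minpoly F x).natDegree) := by
    rw [Finset.sum_filter]
    refine Finset.sum_congr rfl fun x _ => ?_
    split_ifs with h
    · exact kl_char_eq χ a b x h
    · simp only [not_not] at h
      subst h
      simp [klLam, minpoly.zero, hnpos.ne']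
  rw [h1, klA]
  rw [Finset.sum_sigma']
  rw [← Finset.sum_fiberwise_of_maps_to (s := Finset.univ) (t := n.divisorsAntidiagonal.sigma (fun x => klIrr F x.1))
    (g := fun x : E => ⟨((minpoly F x).natDegree, n / (minpoly F x).natDegree), minpoly F x⟩)]
  · refine Finset.sum_congr rfl ?_
    rintro ⟨⟨e, j⟩, P⟩ h
    simp only [Finset.mem_sigma, Nat.mem_divisorsAntidiagonal, mem_klIrr] at h
    obtain ⟨⟨hej, _⟩, hm, hd, hi⟩ := h
    have hepos : 0 < e := by rw [← hd]; exact hi.natDegree_pos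
    have hj : n / e = j := by rw [← hej, Nat.mul_div_cancel_left _ hepos]
    rw [Finset.sum_congr (g := fun _ => klLam χ a b P ^ j) (s₂ := Finset.univ.filter (fun x : E => minpoly F x = P))]
    · rw [Finset.sum_const, kl_card_fiber hm hi (by rw [hd, ← hn, ← hej]; exact dvd_mul_right _ _), hd, nsmul_eq_mul]
    · ext x
      simp only [Finset.mem_filter, Finset.mem_univ, true_and]
      constructor
      · intro h; exact eq_of_heq (Sigma.mk.inj h).2
      · rintro rfl; subst hd; subst hj; rfl
    · intro x hx
      simp only [Finset.mem_filter, Finset.mem_univ, true_and] at hx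
      rw [hx, hd, hj]
  · intro x _
    simp only [Finset.mem_sigma, Nat.mem_divisorsAntidiagonal, mem_klIrr]
    exact ⟨⟨Nat.mul_div_cancel' (hdvd x), hnpos.ne'⟩, minpoly.monic (.of_finite F x), trivial, minpoly.irreducible (.of_finite F x)⟩
end LPart3

section Final
lemma kl_root_bound (α β : ℂ) (q C : ℝ) (hq : 0 < q) (hab : α * β = q) (k0 : ℕ)
    (hb : ∀ k ≥ k0, ‖α ^ (2*k) + β ^ (2*k)‖ ≤ C * q ^ k) : ‖α‖ ≤ √q := by
  by_contra hcon
  push Not at hcon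
  have h1 : q < ‖α‖ ^ 2 := by
    have := Real.sq_sqrt hq.le
    have := Real.sqrt_nonneg q
    nlinarith
  have hn : ‖α‖ * ‖β‖ = q := by rw [← norm_mul, hab]; simp [abs_of_pos hq]
  have h2 : ‖β‖ ^ 2 < q := by
    have h0 : (‖α‖ ^ 2) * ‖β‖^2 = q * q := by rw [← mul_pow, hn, sq]
    by_contra h
    push Not at h
    nlinarith
  have h3 : ∀ k ≥ k0, (‖α‖ ^ 2 / q) ^ k ≤ C + 1 := by
    intro k hk
    have h4 : ‖α ^ (2*k)‖ ≤ ‖α ^ (2*k) + β ^ (2*k)‖ + ‖β ^ (2*k)‖ := by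
      have := norm_sub_le (α ^ (2*k) + β ^ (2*k)) (β ^ (2*k))
      rwa [add_sub_cancel_right] at this
    rw [norm_pow, norm_pow, pow_mul ‖α‖, pow_mul ‖β‖] at h4
    have h5 : (‖β‖ ^ 2) ^ k ≤ q ^ k := pow_le_pow_left₀ (by positivity) h2.le k
    rw [div_pow, div_le_iff₀ (by positivity)]
    have := hb k hk
    linarith
  have h6 := tendsto_pow_atTop_atTop_of_one_lt ((one_lt_div hq).mpr h1)
  obtain ⟨k, hk, hk'⟩ := ((h6.eventually_gt_atTop (C+1)).and (Filter.eventually_ge_atTop k0)).exists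
  linarith [h3 k hk']

lemma kl_final (K : ℂ) (q C : ℝ) (hq : 0 < q) (A : ℕ → ℂ) (h1 : A 1 = K) (h2 : A 2 = 2 * q - K ^ 2)
    (h3 : ∀ d, A (d+3) = -(K * A (d+2)) - q * A (d+1)) (k0 : ℕ)
    (hb : ∀ k ≥ k0, ‖A (2*k)‖ ≤ C * q ^ k) : ‖K‖ ≤ 2 * √q := by
  obtain ⟨s, hs⟩ := IsAlgClosed.exists_eq_mul_self (K ^ 2 - 4 * q)
  set α : ℂ := (-K + s) / 2 with hα
  set β : ℂ := (-K - s) / 2 with hβ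
  have hsum : α + β = -K := by rw [hα, hβ]; ring
  have hprod : α * β = q := by rw [hα, hβ]; linear_combination (1/4 : ℂ) * hs
  have hA : ∀ n, A (n+1) = -(α ^ (n+1) + β ^ (n+1)) ∧ A (n+2) = -(α ^ (n+2) + β ^ (n+2)) := by
    intro n
    induction n with
    | zero =>
      have hK : K = -(α + β) := by rw [hsum]; ring
      refine ⟨by simp [h1, hK], ?_⟩
      simp only [zero_add]
      rw [h2, ← hprod, hK]; ring
    | succ n ih =>
      refine ⟨ih.2, ?_⟩
      have hK : K = -(α + β) := by rw [hsum]; ring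
      rw [show n + 1 + 2 = n + 3 by ring, h3, ih.1, ih.2, ← hprod, hK]; ring
  have hA' : ∀ k ≥ k0 + 1, ‖α ^ (2*k) + β ^ (2*k)‖ ≤ C * q ^ k := by
    intro k hk
    have := hb k (by omega)
    rw [show 2 * k = (2 * k - 1) + 1 by omega, (hA (2*k-1)).1, norm_neg] at this
    rwa [show 2 * k - 1 + 1 = 2 * k by omega] at this
  have b1 := kl_root_bound α β q C hq hprod (k0+1) hA'
  have b2 := kl_root_bound β α q C hq (by rw [mul_comm, hprod]) (k0+1) (fun k hk => by rw [add_comm]; exact hA' k hk)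
  calc ‖K‖ = ‖α + β‖ := by rw [hsum, norm_neg]
    _ ≤ ‖α‖ + ‖β‖ := norm_add_le _ _
    _ ≤ _ := by linarith

lemma kl_reduction {F : Type*} [Field F] [DecidableEq F] [Fintype F] {χ : AddChar F ℂ} (hχ : χ ≠ 1) {a b : F}
    (ha : a ≠ 0) (hb : b ≠ 0) (C : ℝ) (k0 : ℕ) 
    (h : ∀ k ≥ k0, ‖klA χ a b (2*k)‖ ≤ C * (Fintype.card F : ℝ) ^ k) :
    ‖∑ s ∈ Finset.univ.filter (fun s : F => s ≠ 0), χ (a * s + b / s)‖ ≤ 2 * √(Fintype.card F : ℝ) := by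
  rw [← klC_one]
  have e0 := klC_zero χ a b
  have e2 := klC_two hχ ha hb
  have n1 := kl_newton χ a b 1
  have n2 := kl_newton χ a b 2
  simp [e0] at n1
  simp [Finset.sum_Icc_succ_top, e0, e2] at n2
  refine kl_final _ _ C (by exact_mod_cast Fintype.card_pos) (klA χ a b) n1.symm ?_ ?_ k0 h
  · push_cast; rw [n2, ← n1]; ring
  · intro d
    have n3 := kl_newton χ a b (d+3)
    rw [klC_ge_three hχ ha b (by omega)] at n3
    rw [Finset.sum_Icc_succ_top (by omega), Finset.sum_Icc_succ_top (by omega), Finset.sum_Icc_succ_top (by omega)] at n3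
    rw [Finset.sum_eq_zero] at n3
    · simp only [show d + 3 - (d + 1) = 2 by omega, show d + 3 - (d+2) = 1 by omega, 
        show d + 2 + 1 = d + 3 by omega, show d + 1 + 1 = d+2 by omega, Nat.sub_self, e0, e2] at n3
      push_cast
      linear_combination -n3
    · intro n hn
      rw [Finset.mem_Icc] at hn
      rw [klC_ge_three hχ ha b (by omega), mul_zero]
end Final

section Laurent
open PowerSeries

lemma kl_hensel {E : Type*} [Field E] (a b τ : E) (hb : b ≠ 0) (q : ℕ) (hq : 2 ≤ q) :
    ∃ s : PowerSeries E, constantCoeff s = b⁻¹ ∧ 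
      s ^ 2 - C b⁻¹ * (1 - X ^ (q-1) + C τ * X ^ q) * s + C (a / b) * X ^ (2 * q) = 0 := by
  obtain ⟨m, rfl⟩ : ∃ m, q = m + 2 := ⟨q - 2, by omega⟩
  let U : PowerSeries E := C b⁻¹ * (1 - X ^ (m+1) + C τ * X ^ (m+2))
  let V : PowerSeries E := C (a / b) * X ^ (2 * (m+2))
  let f : Polynomial (PowerSeries E) := Polynomial.X ^ 2 - Polynomial.C U * Polynomial.X + Polynomial.C V
  have hU : constantCoeff U = b⁻¹ := by simp [U]
  have hV : constantCoeff V = 0 := by simp [V]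
  have hf : f.Monic := by unfold f; monicity!
  obtain ⟨s, hs, hs'⟩ := HenselianRing.is_henselian (I := Ideal.span {(X : PowerSeries E)}) f hf (C b⁻¹) 
    (by
      rw [Ideal.mem_span_singleton, X_dvd_iff]
      simp [f, hU, hV]; ring)
    (by
      apply IsUnit.map
      rw [isUnit_iff_constantCoeff]
      simp [f, hU]
      rw [show (1 + 1) * b⁻¹ - b⁻¹ = b⁻¹ by ring]
      simpa using hb)
  refine ⟨s, ?_, ?_⟩
  · rw [Ideal.mem_span_singleton, X_dvd_iff, map_sub, sub_eq_zero] at hs'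
    simpa using hs'
  · simpa [f, Polynomial.IsRoot] using hs

lemma kl_laurent {E : Type*} [Field E] (a b τ : E) (ha : a ≠ 0) (hb : b ≠ 0) (q : ℕ) (hq : 2 ≤ q) :
    ∃ x : LaurentSeries E, x ≠ 0 ∧ x.order = -(q : ℤ) ∧ 
      HahnSeries.C a * x ^ 2 + HahnSeries.C b = 
       ((HahnSeries.single (-1 : ℤ) (1 : E)) ^ q - HahnSeries.single (-1 : ℤ) (1 : E) + HahnSeries.C τ) * x := by
  obtain ⟨s, hs0, hs⟩ := kl_hensel a b τ hb q hq
  let S : LaurentSeries E := HahnSeries.ofPowerSeries ℤ E s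
  have hS := congrArg (HahnSeries.ofPowerSeries ℤ E) hs
  simp only [map_add, map_sub, map_mul, map_pow, map_zero, map_one, HahnSeries.ofPowerSeries_C, HahnSeries.ofPowerSeries_X] at hS
  have hc : S.coeff 0 ≠ 0 := by
    have := HahnSeries.ofPowerSeries_apply_coeff (Γ := ℤ) (R := E) s 0
    simp only [Nat.cast_zero] at this
    rw [this, coeff_zero_eq_constantCoeff_apply, hs0]
    exact inv_ne_zero hb
  have hSne : S ≠ 0 := by intro h; rw [h] at hc; simp at hc
  have hSo : S.order = 0 := by
    apply le_antisymm (HahnSeries.order_le_of_coeff_ne_zero hc)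
    by_contra hneg
    push Not at hneg
    have h1 := HahnSeries.coeff_order_eq_zero.not.2 hSne
    rw [PowerSeries.coeff_coe, if_pos hneg] at h1
    exact h1 rfl
  let t : LaurentSeries E := HahnSeries.single (1 : ℤ) (1 : E)
  let y : LaurentSeries E := HahnSeries.single (-1 : ℤ) (1 : E)
  have hty : t * y = 1 := by simp [t, y]
  have hyne : y ≠ 0 := by simp [y]
  have hane : (HahnSeries.C (b / a) : LaurentSeries E) ≠ 0 := by 
    simp [ha, hb]
  refine ⟨HahnSeries.C (b / a) * y ^ q * S, ?_, ?_, ?_⟩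
  · exact mul_ne_zero (mul_ne_zero hane (pow_ne_zero _ hyne)) hSne
  · rw [HahnSeries.order_mul (mul_ne_zero hane (pow_ne_zero _ hyne)) hSne, HahnSeries.order_mul hane (pow_ne_zero _ hyne), 
      HahnSeries.order_pow, hSo, HahnSeries.order_C]
    simp [y, HahnSeries.order_single]
  · change HahnSeries.C a * _ + _ = (y ^ q - y + _) * _
    change S ^ 2 - _ * (1 - t ^ (q-1) + _ * t ^ q) * S + _ * t ^ (2 * q) = 0 at hS
    obtain ⟨m, rfl⟩ : ∃ m, q = m + 1 := ⟨q - 1, by omega⟩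
    simp only [Nat.add_sub_cancel] at hS
    have h1 : ∀ n, t ^ n * y ^ n = 1 := by intro n; rw [← mul_pow, hty, one_pow]
    have hab : (HahnSeries.C (b/a) : LaurentSeries E) * HahnSeries.C a = HahnSeries.C b := by rw [← map_mul]; congr 1; field_simp
    have hbb : (HahnSeries.C b⁻¹ : LaurentSeries E) * HahnSeries.C b = 1 := by rw [← map_mul, inv_mul_cancel₀ hb, map_one]
    have hab' : (HahnSeries.C (a/b) : LaurentSeries E) * HahnSeries.C (b/a) = 1 := by rw [← map_mul, ← map_one HahnSeries.C]; congr 1; field_simp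
    generalize (HahnSeries.C (b/a) : LaurentSeries E) = ba at *
    generalize (HahnSeries.C (a/b) : LaurentSeries E) = ab at *
    generalize (HahnSeries.C b⁻¹ : LaurentSeries E) = bi at *
    generalize (HahnSeries.C b : LaurentSeries E) = B at *
    generalize (HahnSeries.C a : LaurentSeries E) = A at *
    generalize (HahnSeries.C τ : LaurentSeries E) = T at *
    have e1 := h1 m
    rw [mul_comm 2 (m+1), pow_mul t, pow_succ t m] at hS
    rw [pow_succ y m]
    generalize t ^ m = tm at *
    generalize y ^ m = Yp at *
    have k1 : A * ba * ba * bi = ba := by linear_combination ba * bi * hab + ba * hbb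
    have k2 : A * ba * ba * ab = B := by linear_combination A * ba * hab' + hab
    have k3 : tm * (Yp * y) ^ 2 = Yp * y * y := by linear_combination Yp * y ^ 2 * e1
    have k4 : (tm * t) * (Yp * y) ^ 2 = Yp * y := by linear_combination (Yp * y) * t * y * e1 + Yp * y * hty
    have k5 : (tm * t) ^ 2 * (Yp * y) ^ 2 = 1 := by linear_combination (tm * t) * k4 + t * y * e1 + hty
    linear_combination (A * ba ^ 2 * (Yp * y) ^ 2) * hS + ((Yp * y) ^ 2 - tm * (Yp * y) ^ 2 + T * (tm * t) * (Yp * y) ^ 2) * S * k1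
      + ba * S * (-k3 + T * k4) - (tm * t) ^ 2 * (Yp * y) ^ 2 * k2 - B * k5
end Laurent

section Stepanov
open Polynomial

/-- reduction of powers of `x` modulo the quadratic equation. -/
noncomputable def klRed {E : Type*} [Field E] (a b : E) (Y : E[X]) : ℕ → E[X] × E[X]
  | 0 => (1, 0)
  | n + 1 => (- C (b / a) * (klRed a b Y n).2, (klRed a b Y n).1 + C a⁻¹ * Y * (klRed a b Y n).2)

lemma klRed_spec {E : Type*} [Field E] (a b : E) (ha : a ≠ 0) (Y : E[X]) {R : Type*} [CommRing R]
    (φ : E →+* R) (x y : R) (h : φ a * x ^ 2 + φ b = eval₂ φ y Y * x) (n : ℕ) :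
    x ^ n = eval₂ φ y (klRed a b Y n).1 + eval₂ φ y (klRed a b Y n).2 * x := by
  induction n with
  | zero => simp [klRed]
  | succ n ih =>
    have h1 : φ a⁻¹ * φ a = 1 := by rw [← map_mul, inv_mul_cancel₀ ha, map_one]
    have h2 : φ (b / a) = φ b * φ a⁻¹ := by rw [← map_mul, div_eq_mul_inv]
    rw [pow_succ, ih]
    simp only [klRed, eval₂_mul, eval₂_add, eval₂_neg, eval₂_C, h2]
    linear_combination (eval₂ φ y (klRed a b Y n).2) * (φ a⁻¹ * h - x ^ 2 * h1)

noncomputable def klAB {E : Type*} [Field E] (a b : E) (Y : E[X]) {ι : Type*} (S : Finset ι) (d : ι → E) (u v : ι → ℕ) : E[X] × E[X] :=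
  (∑ i ∈ S, C (d i) * (klRed a b Y (u i)).1 * X ^ (v i), ∑ i ∈ S, C (d i) * (klRed a b Y (u i)).2 * X ^ (v i))

lemma klAB_spec {E : Type*} [Field E] (a b : E) (ha : a ≠ 0) (Y : E[X]) {ι : Type*} (S : Finset ι) (d : ι → E) (u v : ι → ℕ)
   {R : Type*} [CommRing R]
    (φ : E →+* R) (x y : R) (h : φ a * x ^ 2 + φ b = eval₂ φ y Y * x) :
    ∑ i ∈ S, φ (d i) * x ^ (u i) * y ^ (v i) = eval₂ φ y (klAB a b Y S d u v).1 + eval₂ φ y (klAB a b Y S d u v).2 * x := by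
  simp only [klAB, eval₂_finsetSum, sum_mul, ← sum_add_distrib]
  refine sum_congr rfl fun i _ => ?_
  rw [klRed_spec a b ha Y φ x y h (u i)]
  simp only [eval₂_mul, eval₂_C, eval₂_pow, eval₂_X]
  ring

noncomputable def klY {E : Type*} [Field E] (τ : E) (q : ℕ) : E[X] := X ^ q - X + C τ

lemma klY_natDegree {E : Type*} [Field E] (τ : E) (q : ℕ) (hq : 2 ≤ q) : (klY τ q).natDegree = q := by
  unfold klY
  have h0 : q ≠ 0 := by omega
  have h1 : 1 < q := by omega
  compute_degree
  all_goals first | omega | simp [h0, h1.ne', h1.ne] | skip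

lemma kl_addVal_mono {E : Type*} [Field E] (f g : LaurentSeries E) (α β : ℤ)
    (hf : HahnSeries.addVal ℤ E f = (α : WithTop ℤ)) (hg : HahnSeries.addVal ℤ E g = (β : WithTop ℤ)) (c : E) (hc : c ≠ 0) (u v : ℕ) :
    HahnSeries.addVal ℤ E (HahnSeries.C c * f ^ u * g ^ v) = ((u * α + v * β : ℤ) : WithTop ℤ) := by
  have h0 : HahnSeries.addVal ℤ E (HahnSeries.C c : LaurentSeries E) = ((0 : ℤ) : WithTop ℤ) := by
    rw [HahnSeries.addVal_apply_of_ne (by simpa using hc), HahnSeries.order_C]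
  rw [AddValuation.map_mul, AddValuation.map_mul, AddValuation.map_pow, AddValuation.map_pow, hf, hg, h0]
  rw [← WithTop.coe_nsmul, ← WithTop.coe_nsmul, ← WithTop.coe_add, ← WithTop.coe_add]
  simp

lemma kl_sum_ne_zero {E : Type*} [Field E] {ι : Type*} (S : Finset ι) (f : ι → LaurentSeries E) (o : ι → ℤ)
   (hf : ∀ i ∈ S, HahnSeries.addVal ℤ E (f i) = (o i : WithTop ℤ)) (ho : Set.InjOn o S) (hS : S.Nonempty) :
   ∑ i ∈ S, f i ≠ 0 := by
  classical
  obtain ⟨i, hi, hmin⟩ := S.exists_min_image o hS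
  intro h
  have h1 := congrArg (fun g => HahnSeries.coeff g (o i)) h
  simp only [HahnSeries.coeff_sum, HahnSeries.coeff_zero] at h1
  rw [sum_eq_single i] at h1
  · exact HahnSeries.coeff_orderTop_ne (hf i hi) h1
  · intro j hj hji
    apply HahnSeries.coeff_eq_zero_of_lt_orderTop
    have := hf j hj
    rw [HahnSeries.addVal_apply] at this
    rw [this, WithTop.coe_lt_coe]
    exact lt_of_le_of_ne (hmin j hj) (fun h => hji (ho hj hi h.symm))
  · exact fun h => absurd hi h

lemma kl_coeff_eval {E : Type*} [Field E] (N : E[X]) (n : ℕ) :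
   (eval₂ (HahnSeries.C : E →+* LaurentSeries E) (HahnSeries.single (-1 : ℤ) (1 : E)) N).coeff (-(n:ℤ)) = N.coeff n := by
  induction N using Polynomial.induction_on' with
  | add p r hp hr => simp [eval₂_add, hp, hr]
  | monomial k c =>
    rw [eval₂_monomial, HahnSeries.single_pow, HahnSeries.C_mul_eq_smul, HahnSeries.coeff_smul, coeff_monomial]
    simp only [HahnSeries.coeff_single, one_pow, smul_eq_mul, nsmul_eq_mul, mul_neg, mul_one, neg_inj, Nat.cast_inj]
    by_cases h : k = n
    · simp [h]
    · simp [h, Ne.symm h]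

noncomputable def klN {E : Type*} [Field E] (a b : E) (Y A B : E[X]) : E[X] := C a * A ^ 2 + Y * A * B + C b * B ^ 2

lemma klN_ne {E : Type*} [Field E] (a b : E) (ha : a ≠ 0) (hb : b ≠ 0) (Y A B : E[X]) (hY : 0 < Y.natDegree) 
   (h : klN a b Y A B = 0) : A = 0 ∧ B = 0 := by
  classical
  by_contra hne
  have hg : EuclideanDomain.gcd A B ≠ 0 := by
    rwa [Ne, EuclideanDomain.gcd_eq_zero_iff]
  obtain ⟨A', hA⟩ := EuclideanDomain.gcd_dvd_left A B
  obtain ⟨B', hB⟩ := EuclideanDomain.gcd_dvd_right A B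
  have hco : IsCoprime A' B' := by
    refine ⟨EuclideanDomain.gcdA A B, EuclideanDomain.gcdB A B, ?_⟩
    have := EuclideanDomain.gcd_eq_gcd_ab A B
    apply mul_left_cancel₀ hg
    generalize EuclideanDomain.gcd A B = g at *
    generalize EuclideanDomain.gcdA A B = r at *
    generalize EuclideanDomain.gcdB A B = s at *
    linear_combination -this - r * hA - s * hB
  generalize EuclideanDomain.gcd A B = g at *
  have h2 : C a * A' ^ 2 + Y * A' * B' + C b * B' ^ 2 = 0 := by
    apply mul_left_cancel₀ (pow_ne_zero 2 hg)
    unfold klN at h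
    rw [hA, hB] at h
    linear_combination h
  have hua : IsUnit (C a) := isUnit_C.2 ha.isUnit
  have hub : IsUnit (C b) := isUnit_C.2 hb.isUnit
  have hB' : IsUnit B' := by
    have : B' ∣ C a * A' ^ 2 := ⟨-(Y * A' + C b * B'), by linear_combination h2⟩
    have h3 : B' ∣ A' ^ 2 := (hua.dvd_mul_left).1 this
    exact (hco.symm.pow_right (n := 2)).isUnit_of_dvd' dvd_rfl h3
  have hA' : IsUnit A' := by
    have : A' ∣ C b * B' ^ 2 := ⟨-(Y * B' + C a * A'), by linear_combination h2⟩
    have h3 : A' ∣ B' ^ 2 := (hub.dvd_mul_left).1 this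
    exact (hco.pow_right (n := 2)).isUnit_of_dvd' dvd_rfl h3
  obtain ⟨α, hα, rfl⟩ := Polynomial.isUnit_iff.1 hA'
  obtain ⟨β, hβ, rfl⟩ := Polynomial.isUnit_iff.1 hB'
  have h4 : Y * C (α * β) = C (-(a * α^2 + b * β ^ 2)) := by
    simp only [C_mul, C_neg, C_add, C_pow]
    linear_combination h2
  have h5 := congrArg natDegree h4
  rw [natDegree_mul_C (mul_ne_zero hα.ne_zero hβ.ne_zero), natDegree_C] at h5
  omega
end Stepanov

section Stepanov2
open Polynomial

lemma kl_stepanov_N {E : Type*} [Field E] (a b τ : E) (ha : a ≠ 0) (hb : b ≠ 0) (q : ℕ) (hq : 2 ≤ q)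
   {ι : Type*} (S : Finset ι) (d : ι → E) (u v : ι → ℕ) (D : ℕ) (hS : S.Nonempty) (hd : ∀ i ∈ S, d i ≠ 0)
   (hinj : Set.InjOn (fun i => q * u i + v i) S) (hD : ∀ i ∈ S, q * u i + v i ≤ D) (hv : ∀ i ∈ S, v i ≤ q * u i) :
   klN a b (klY τ q) (klAB a b (klY τ q) S d u v).1 (klAB a b (klY τ q) S d u v).2 ≠ 0 ∧ 
   (klN a b (klY τ q) (klAB a b (klY τ q) S d u v).1 (klAB a b (klY τ q) S d u v).2).natDegree ≤ D := by
  obtain ⟨x, hx0, hxo, hx⟩ := kl_laurent a b τ ha hb q hq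
  set y : LaurentSeries E := HahnSeries.single (-1 : ℤ) (1 : E) with hy
  let φ : E →+* LaurentSeries E := HahnSeries.C
  have hYe : eval₂ φ y (klY τ q) = y ^ q - y + φ τ := by
    simp [klY, eval₂_sub]
  have hfa : φ a ≠ 0 := by simpa [φ] using ha
  have hfb : φ b ≠ 0 := by simpa [φ] using hb
  have hx1 : φ a * x ^ 2 + φ b = eval₂ φ y (klY τ q) * x := by rw [hYe]; exact hx
  let z : LaurentSeries E := φ b / (φ a * x)
  have hz1 : φ a * (x * z) = φ b := by simp only [z]; field_simp
  have hz0 : z ≠ 0 := div_ne_zero hfb (mul_ne_zero hfa hx0)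
  have hxz : φ a * (x + z) = eval₂ φ y (klY τ q) := by
    apply mul_right_cancel₀ hx0
    linear_combination hx1 + hz1
  have hz2 : φ a * z ^ 2 + φ b = eval₂ φ y (klY τ q) * z := by
    rw [← hxz, ← hz1]; ring
  have vx : HahnSeries.addVal ℤ E x = ((-(q:ℤ) : ℤ) : WithTop ℤ) := by
    rw [HahnSeries.addVal_apply_of_ne hx0, hxo]
  have vy : HahnSeries.addVal ℤ E y = ((-1 : ℤ) : WithTop ℤ) := by
    rw [HahnSeries.addVal_apply_of_ne (by simp [hy]), hy, HahnSeries.order_single one_ne_zero]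
  have vz : HahnSeries.addVal ℤ E z = ((q : ℤ) : WithTop ℤ) := by
    have h1 : z.order = (q : ℤ) := by
      have h2 := congrArg HahnSeries.order hz1
      rw [HahnSeries.order_mul hfa (mul_ne_zero hx0 hz0), HahnSeries.order_mul hx0 hz0, HahnSeries.order_C, HahnSeries.order_C, hxo] at h2
      linarith
    rw [HahnSeries.addVal_apply_of_ne hz0, h1]
  have hHx := klAB_spec a b ha (klY τ q) S d u v φ x y hx1
  have hHz := klAB_spec a b ha (klY τ q) S d u v φ z y hz2
  set A := (klAB a b (klY τ q) S d u v).1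
  set B := (klAB a b (klY τ q) S d u v).2
  have hne : ∑ i ∈ S, φ (d i) * x ^ (u i) * y ^ (v i) ≠ 0 := by
    apply kl_sum_ne_zero S _ (fun i => (u i : ℤ) * (-(q:ℤ)) + v i * (-1))
    · intro i hi
      exact kl_addVal_mono x y _ _ vx vy (d i) (hd i hi) _ _
    · intro i hi j hj hij
      apply hinj hi hj
      simp only at hij ⊢
      have : (q : ℤ) * u i + v i = q * u j + v j := by linarith
      exact_mod_cast this
    · exact hS
  have hN0 : klN a b (klY τ q) A B ≠ 0 := by
    intro h
    obtain ⟨hA, hB⟩ := klN_ne a b ha hb _ A B (by rw [klY_natDegree τ q hq]; omega) h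
    rw [hA, hB] at hHx
    apply hne
    rw [hHx]; simp
  refine ⟨hN0, ?_⟩
  have hNe : eval₂ φ y (klN a b (klY τ q) A B) = φ a * (∑ i ∈ S, φ (d i) * x ^ (u i) * y ^ (v i)) * (∑ i ∈ S, φ (d i) * z ^ (u i) * y ^ (v i)) := by
    rw [hHx, hHz]
    simp only [klN, eval₂_add, eval₂_mul, eval₂_pow, eval₂_C, map_one]
    rw [← hxz, ← hz1]; ring
  have v1 : ((-(D:ℤ) : ℤ) : WithTop ℤ) ≤ HahnSeries.addVal ℤ E (∑ i ∈ S, φ (d i) * x ^ (u i) * y ^ (v i)) := by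
    apply AddValuation.map_le_sum
    intro i hi
    rw [kl_addVal_mono x y _ _ vx vy (d i) (hd i hi), WithTop.coe_le_coe]
    have := hD i hi
    zify at this
    linarith
  have v2 : ((0 : ℤ) : WithTop ℤ) ≤ HahnSeries.addVal ℤ E (∑ i ∈ S, φ (d i) * z ^ (u i) * y ^ (v i)) := by
    apply AddValuation.map_le_sum
    intro i hi
    rw [kl_addVal_mono z y _ _ vz vy (d i) (hd i hi), WithTop.coe_le_coe]
    have := hv i hi
    zify at this
    linarith
  have v0 : HahnSeries.addVal ℤ E (φ a) = ((0 : ℤ) : WithTop ℤ) := by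
    rw [HahnSeries.addVal_apply_of_ne hfa, HahnSeries.order_C]
  have v3 : ((-(D:ℤ) : ℤ) : WithTop ℤ) ≤ HahnSeries.addVal ℤ E (eval₂ φ y (klN a b (klY τ q) A B)) := by
    rw [hNe, AddValuation.map_mul, AddValuation.map_mul, v0]
    have := add_le_add v1 v2
    rw [← WithTop.coe_add, add_zero] at this
    simpa using this
  have v4 := v3.trans (HahnSeries.addVal_le_of_coeff_ne_zero (g := -((klN a b (klY τ q) A B).natDegree : ℤ)) 
    (by rw [kl_coeff_eval]; simpa using hN0))
  rw [WithTop.coe_le_coe] at v4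
  omega

lemma kl_count {E : Type*} [Field E] [Fintype E] [DecidableEq E] (a b τ : E) (ha : a ≠ 0) (q : ℕ) 
   (A B : E[X]) (hN : klN a b (klY τ q) A B ≠ 0) 
   (h : ∀ x y : E, a * x ^ 2 + b = (y ^ q - y + τ) * x → A.eval y + B.eval y * x = 0) :
   #{z : E × E | a * z.1 ^ 2 + b = (z.2 ^ q - z.2 + τ) * z.1} ≤ (klN a b (klY τ q) A B).natDegree := by
  set N := klN a b (klY τ q) A B with hNdef
  rw [card_eq_sum_card_fiberwise (f := fun z => z.2) (t := univ) (by simp)]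
  calc _ ≤ ∑ y : E, N.roots.count y := by
        apply sum_le_sum
        intro y _
        have hcard : #({z ∈ ({z : E × E | a * z.1 ^ 2 + b = (z.2 ^ q - z.2 + τ) * z.1} : Finset (E × E)) | z.2 = y}) 
            = #{x : E | a * x ^ 2 + b = (y ^ q - y + τ) * x} := by
          symm
          apply card_bij (fun x _ => (x, y))
          · intro x hx; simpa using hx
          · intro x _ x' _ h; simpa using h
          · rintro ⟨x, y'⟩ hx
            simp only [mem_filter, mem_univ, true_and] at hx
            obtain ⟨h1, rfl⟩ := hx
            exact ⟨x, by simpa using h1, rfl⟩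
        rw [hcard, count_roots]
        have key : ∀ x, a * x ^ 2 + b = (y ^ q - y + τ) * x → A.eval y + B.eval y * x = 0 := fun x => h x y
        have hYe : (klY τ q).eval y = y ^ q - y + τ := by simp [klY]
        by_cases h2 : ∃ x x', x ≠ x' ∧ a * x ^ 2 + b = (y ^ q - y + τ) * x ∧ a * x' ^ 2 + b = (y ^ q - y + τ) * x'
        · obtain ⟨x, x', hne, hx, hx'⟩ := h2
          have hB : B.eval y = 0 := by
            have := key x hx
            have := key x' hx'
            have : B.eval y * (x - x') = 0 := by linear_combination key x hx - key x' hx'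
            exact (mul_eq_zero.1 this).resolve_right (sub_ne_zero.2 hne)
          have hA : A.eval y = 0 := by have := key x hx; rw [hB] at this; simpa using this
          have hsum : a * (x + x') = y ^ q - y + τ := by
            apply mul_right_cancel₀ (sub_ne_zero.2 hne)
            linear_combination hx - hx'
          have hle : #{x : E | a * x ^ 2 + b = (y ^ q - y + τ) * x} ≤ 2 := by
            refine (card_le_card (t := {x, x'}) ?_).trans card_le_two
            intro w hw
            simp only [mem_filter, mem_univ, true_and] at hw
            simp only [mem_insert, mem_singleton]
            have : a * ((w - x) * (w - x')) = 0 := by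
              have e1 : b = a * x * x' := by
                linear_combination hx - x * hsum
              linear_combination hw - e1 - w * hsum
            rcases mul_eq_zero.1 ((mul_eq_zero.1 this).resolve_left ha) with h | h
            · left; exact sub_eq_zero.1 h
            · right; exact sub_eq_zero.1 h
          refine hle.trans ?_
          rw [le_rootMultiplicity_iff hN]
          obtain ⟨A', hA'⟩ := dvd_iff_isRoot.2 hA
          obtain ⟨B', hB'⟩ := dvd_iff_isRoot.2 hB
          refine ⟨klN a b (klY τ q) A' B', ?_⟩
          rw [hNdef, klN, klN, hA', hB']; ring
        · by_cases h1 : ∃ x, a * x ^ 2 + b = (y ^ q - y + τ) * x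
          · obtain ⟨x, hx⟩ := h1
            have hle : #{x : E | a * x ^ 2 + b = (y ^ q - y + τ) * x} ≤ 1 := by
              rw [card_le_one]
              intro w hw w' hw'
              simp only [mem_filter, mem_univ, true_and] at hw hw'
              by_contra hne
              exact h2 ⟨w, w', hne, hw, hw'⟩
            refine hle.trans ?_
            rw [Nat.one_le_iff_ne_zero, ← Nat.pos_iff_ne_zero, rootMultiplicity_pos hN]
            simp only [IsRoot, hNdef, klN, eval_add, eval_mul, eval_pow, eval_C, hYe]
            have hk := key x hx
            linear_combination (a * A.eval y - a * x * B.eval y + (y ^ q - y + τ) * B.eval y) * hk + (B.eval y) ^ 2 * hx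
          · push Not at h1
            rw [filter_eq_empty_iff.2 (fun x _ => h1 x)]
            simp
    _ ≤ N.roots.card := by
        rw [← Multiset.toFinset_sum_count_eq]
        apply (sum_subset (subset_univ _) _).ge
        intro x _ hx
        rw [Multiset.count_eq_zero]
        simpa using hx
    _ ≤ _ := card_roots' N
end Stepanov2

section Stepanov3
open Polynomial

/-- pole orders -/
def klW (q M : ℕ) : Finset ℕ := insert 0 (Icc q M)

lemma klW_card (q M : ℕ) (hq : 2 ≤ q) (hM : q ≤ M) : #(klW q M) + q = M + 2 := by
  unfold klW
  rw [card_insert_of_notMem (by simp; omega), Nat.card_Icc]; omega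

lemma klW_mod (q M w : ℕ) (hq : 2 ≤ q) (hw : w ∈ klW q M) : w % q ≤ q * (w / q) ∧ w ≤ M := by
  simp only [klW, mem_insert, mem_Icc] at hw
  rcases hw with rfl | ⟨h1, h2⟩
  · simp
  · have h3 : w % q < q := Nat.mod_lt _ (by omega)
    have h4 : 1 ≤ w / q := (Nat.one_le_div_iff (by omega)).2 h1
    exact ⟨by nlinarith, h2⟩

lemma kl_span {E R : Type*} [Field E] [CommRing R] [Algebra E R] (x xi y : R) (a b τ : E) (q : ℕ) (hq : 2 ≤ q)
   (hx : x * xi = 1) (hy : y ^ q = y + a • x + b • xi - τ • 1) (M : ℕ) (v : ℕ) : ∀ u, v ≤ q * u → q * u + v ≤ M →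
   x ^ u * y ^ v ∈ Submodule.span E ((fun w => x ^ (w / q) * y ^ (w % q)) '' (klW q M : Set ℕ)) := by
  classical
  induction v using Nat.strong_induction_on with
  | _ v ih =>
  intro u huv hM
  by_cases hv : v < q
  · apply Submodule.subset_span
    refine ⟨q * u + v, ?_, ?_⟩
    · simp only [klW, coe_insert, coe_Icc, Set.mem_insert_iff, Set.mem_Icc]
      rcases Nat.eq_zero_or_pos u with rfl | h
      · left; omega
      · right; exact ⟨by nlinarith, hM⟩
    · simp only
      rw [Nat.mul_add_mod, Nat.mod_eq_of_lt hv, Nat.mul_add_div (by omega), Nat.div_eq_of_lt hv, add_zero]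
  · push Not at hv
    obtain ⟨v, rfl⟩ := Nat.exists_eq_add_of_le' hv
    rcases u with _ | u
    · omega
    have e : x ^ (u+1) * y ^ (v + q) = x ^ (u+1) * y ^ (v + 1) + a • (x ^ (u + 2) * y ^ v) + b • (x ^ u * y ^ v) - τ • (x ^ (u+1) * y ^ v) := by
      rw [pow_add y v q, hy]
      simp only [Algebra.smul_def, mul_one]
      linear_combination (x ^ u * y ^ v * algebraMap E R b) * hx
    rw [e]
    simp only [Nat.mul_add, mul_one] at *
    refine Submodule.sub_mem _ (Submodule.add_mem _ (Submodule.add_mem _ ?_ ?_) ?_) ?_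
    · exact ih (v+1) (by omega) (u+1) (by rw [mul_add]; omega) (by rw [mul_add]; omega)
    · exact Submodule.smul_mem _ _ (ih v (by omega) (u+2) (by rw [mul_add]; omega) (by rw [mul_add]; omega))
    · exact Submodule.smul_mem _ _ (ih v (by omega) u (by omega) (by omega))
    · exact Submodule.smul_mem _ _ (ih v (by omega) (u+1) (by rw [mul_add]; omega) (by rw [mul_add]; omega))

lemma kl_dep {E R ι : Type*} [Field E] [AddCommGroup R] [Module E R] [DecidableEq R] (I : Finset ι) (f : ι → R) (T : Finset R)
   (hf : ∀ i ∈ I, f i ∈ Submodule.span E (T : Set R)) (hc : #T < #I) :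
   ∃ c : ι → E, ∑ i ∈ I, c i • f i = 0 ∧ ∃ i ∈ I, c i ≠ 0 := by
  by_contra hcon
  push Not at hcon
  have hli : LinearIndepOn E f (I : Set ι) := by
    rw [linearIndepOn_finset_iff]
    exact hcon
  have hli' : LinearIndependent E (fun i : I => f i) := hli
  have h1 := finrank_span_eq_card hli'
  have h2 : Submodule.span E (Set.range (fun i : I => f i)) ≤ Submodule.span E (T : Set R) := by
    rw [Submodule.span_le]
    rintro _ ⟨i, rfl⟩
    exact hf i i.2
  have h3 := Submodule.finrank_mono h2
  have h4 := finrank_span_finset_le_card (R := E) T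
  rw [h1, Fintype.card_coe] at h3
  rw [Set.finrank] at h4
  omega

lemma kl_points {E : Type*} [Field E] [Fintype E] [DecidableEq E] (a b τ : E) (ha : a ≠ 0) (hb : b ≠ 0) (q : ℕ) (hq : 2 ≤ q)
   (p r P : ℕ) [Fact p.Prime] [CharP E p] (hP : P = p ^ r) (hE : Fintype.card E = P ^ 2) (hPq : q ^ 2 < P) :
   #{z : E × E | a * z.1 ^ 2 + b = (z.2 ^ q - z.2 + τ) * z.1} ≤ P ^ 2 + 2 * q * P := by
  classical
  let Xt := {z : E × E // a * z.1 ^ 2 + b = (z.2 ^ q - z.2 + τ) * z.1}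
  let x : Xt → E := fun z => z.1.1
  let xi : Xt → E := fun z => (z.1.1)⁻¹
  let y : Xt → E := fun z => z.1.2
  have hx0 : ∀ z : Xt, z.1.1 ≠ 0 := by
    intro z hz
    have := z.2
    rw [hz] at this
    simp at this
    exact hb this
  have hxi : x * xi = 1 := by
    ext z
    simp [x, xi, hx0 z]
  have hy : y ^ q = y + a • x + b • xi - τ • 1 := by
    ext z
    have h1 := z.2
    have h2 := hx0 z
    simp only [x, xi, y, Pi.pow_apply, Pi.add_apply, Pi.sub_apply, Pi.smul_apply, smul_eq_mul, Pi.one_apply]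
    field_simp
    linear_combination -h1
  obtain ⟨s, hs⟩ : ∃ s, P = s + 1 + q := by
    have h : q + 1 ≤ P := by nlinarith
    exact ⟨P - 1 - q, by omega⟩
  let ℓ := P - 1
  let m := P + 2 * (q - 1)
  have hqP : q ≤ P - 1 := by omega
  have hdep := kl_dep (E := E) (klW q ℓ ×ˢ klW q m) (fun ij => (x ^ (ij.1 / q) * y ^ (ij.1 % q)) ^ P * (x ^ (ij.2 / q) * y ^ (ij.2 % q)))
    ((klW q (ℓ * P + m)).image (fun w => x ^ (w / q) * y ^ (w % q)))
    (by
      rintro ⟨i, j⟩ hij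
      rw [mem_product] at hij
      obtain ⟨hi1, hi2⟩ := klW_mod q _ _ hq hij.1
      obtain ⟨hj1, hj2⟩ := klW_mod q _ _ hq hij.2
      simp only at hi1 hi2 hj1 hj2
      have e : (x ^ (i / q) * y ^ (i % q)) ^ P * (x ^ (j / q) * y ^ (j % q)) = x ^ (i / q * P + j / q) * y ^ (i % q * P + j % q) := by
        rw [mul_pow, ← pow_mul, ← pow_mul, pow_add, pow_add]; ring
      simp only
      rw [e]
      have hi3 := Nat.div_add_mod i q
      have hj3 := Nat.div_add_mod j q
      rw [coe_image]
      have := kl_span x xi y a b τ q hq hxi hy (ℓ * P + m) (i % q * P + j % q) (i / q * P + j / q) (by nlinarith) (by nlinarith)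
      exact this)
    (by
      refine card_image_le.trans_lt ?_
      rw [card_product]
      have c1 := klW_card q ℓ hq hqP
      have c2 := klW_card q m hq (by omega)
      have c3 := klW_card q (ℓ * P + m) hq (by nlinarith [Nat.zero_le (ℓ * P), show q ≤ m by omega])
      have d1 : #(klW q ℓ) = s + 2 := by omega
      have d2 : #(klW q m) = s + 1 + 2 * q := by omega
      have d4 : m = s + 3 * q - 1 := by omega
      have d5 : ℓ = s + q := by omega
      have d6 : m + 1 = s + 3 * q := by omega
      rw [d1, d2]
      rw [d5] at c3 ⊢
      rw [hs] at c3 hPq ⊢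
      nlinarith)
  obtain ⟨c, hc, i0, hi0, hci0⟩ := hdep
  let S := (klW q ℓ ×ˢ klW q m).filter (fun i => c i ≠ 0)
  let d : ℕ × ℕ → E := fun i => c i ^ P
  let u : ℕ × ℕ → ℕ := fun i => i.1 / q + P * (i.2 / q)
  let v : ℕ × ℕ → ℕ := fun i => i.1 % q + P * (i.2 % q)
  have huv : ∀ i, q * u i + v i = i.1 + P * i.2 := by
    intro i
    have hi3 := Nat.div_add_mod i.1 q
    have hj3 := Nat.div_add_mod i.2 q
    simp only [u, v]
    nlinarith
  have hSmem : ∀ i ∈ S, i.1 ∈ klW q ℓ ∧ i.2 ∈ klW q m ∧ c i ≠ 0 := by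
    intro i hi
    simp only [S, mem_filter, mem_product] at hi
    tauto
  have hmain := kl_stepanov_N a b τ ha hb q hq S d u v (ℓ + P * m) ⟨i0, by simp only [S, mem_filter]; exact ⟨hi0, hci0⟩⟩
    (fun i hi => pow_ne_zero _ (hSmem i hi).2.2)
    (by
      intro i hi j hj hij
      simp only [huv] at hij
      have h1 := (klW_mod q _ _ hq (hSmem i hi).1).2
      have h2 := (klW_mod q _ _ hq (hSmem j hj).1).2
      have e1 : i.1 < P := by omega
      have e2 : j.1 < P := by omega
      have f1 : i.1 = j.1 := by
        have := congrArg (· % P) hij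
        simpa [Nat.add_mul_mod_self_left, Nat.mod_eq_of_lt e1, Nat.mod_eq_of_lt e2] using this
      have f2 : i.2 = j.2 := by
        rw [f1] at hij
        exact Nat.eq_of_mul_eq_mul_left (by omega) (Nat.add_left_cancel hij)
      exact Prod.ext f1 f2)
    (by
      intro i hi
      rw [huv]
      have h1 := (klW_mod q _ _ hq (hSmem i hi).1).2
      have h2 := (klW_mod q _ _ hq (hSmem i hi).2.1).2
      exact add_le_add h1 (Nat.mul_le_mul_left _ h2))
    (by
      intro i hi
      have h1 := (klW_mod q _ _ hq (hSmem i hi).1).1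
      have h2 := (klW_mod q _ _ hq (hSmem i hi).2.1).1
      simp only [u, v]
      nlinarith)
  obtain ⟨hN, hdeg⟩ := hmain
  have hvan : ∀ x y : E, a * x ^ 2 + b = (y ^ q - y + τ) * x → ∑ i ∈ S, d i * x ^ (u i) * y ^ (v i) = 0 := by
    intro x' y' hxy
    have h1 := congrFun hc ⟨(x', y'), hxy⟩
    simp only [Finset.sum_apply, Pi.smul_apply, Pi.mul_apply, Pi.pow_apply, Pi.zero_apply, smul_eq_mul, x, y] at h1
    have h2 := congrArg (· ^ P) h1
    have hP0 : P ≠ 0 := by omega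
    rw [zero_pow hP0] at h2
    rw [hP, sum_pow_char_pow, ← hP] at h2
    rw [← h2]
    have hcard : ∀ w : E, (w ^ P) ^ P = w := by
      intro w
      rw [← pow_mul, ← sq, ← hE, FiniteField.pow_card]
    rw [sum_filter_of_ne (p := fun i => c i ≠ 0)]
    · refine sum_congr rfl fun i _ => ?_
      rw [mul_pow, mul_pow ((_ : E) ^ P), hcard]
      simp only [d, u, v, pow_add, pow_mul', mul_pow]
      ring
    · intro i _ hne hci
      apply hne
      simp only [d, hci, zero_pow hP0, zero_mul]
  have hfin := kl_count a b τ ha q _ _ hN (by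
    intro x y hxy
    have hs := klAB_spec a b ha (klY τ q) S d u v (RingHom.id E) x y (by
      simp only [RingHom.id_apply, eval₂_id]
      simpa [klY] using hxy)
    simp only [RingHom.id_apply, eval₂_id] at hs
    rw [← hs]
    exact hvan x y hxy)
  refine hfin.trans (hdeg.trans ?_)
  have d4 : m + 2 = P + 2 * q := by omega
  have d5 : ℓ + 1 = P := by omega
  nlinarith
end Stepanov3

section Avg

lemma kl_avg {E : Type*} [Field E] [Fintype E] [DecidableEq E] (Ψ : AddChar E ℂ) (hΨ1 : Ψ ≠ 1) (q : ℕ)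
   (hΨ : ∀ y, Ψ (y ^ q - y) = 1) (a b : E) (hb : b ≠ 0) (D : ℕ)
   (hM : ∀ τ, #{z : E × E | a * z.1 ^ 2 + b = (z.2 ^ q - z.2 + τ) * z.1} ≤ Fintype.card E + D) :
   ‖∑ x ∈ univ.filter (fun x : E => x ≠ 0), Ψ (a * x + b / x)‖ ≤ D + 1 := by
  set K := ∑ x ∈ univ.filter (fun x : E => x ≠ 0), Ψ (a * x + b / x) with hK
  set Q := Fintype.card E with hQ
  let M : E → ℕ := fun τ => #{z : E × E | a * z.1 ^ 2 + b = (z.2 ^ q - z.2 + τ) * z.1}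
  have hgen : ∀ f : E → ℂ, ∑ τ, f τ * (M τ : ℂ) = ∑ x ∈ univ.filter (fun x : E => x ≠ 0), ∑ y : E, f (a * x + b / x - (y ^ q - y)) := by
    intro f
    have h1 : ∀ τ, f τ * (M τ : ℂ) = ∑ x : E, ∑ y : E, if a * x ^ 2 + b = (y ^ q - y + τ) * x then f τ else 0 := by
      intro τ
      simp only [M]
      rw [mul_comm, ← nsmul_eq_mul, ← sum_const, sum_filter, ← univ_product_univ, sum_product]
    simp only [h1]
    rw [sum_comm, sum_filter]
    refine sum_congr rfl fun x _ => ?_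
    rw [sum_comm]
    split_ifs with hx
    · refine sum_congr rfl fun y _ => ?_
      rw [sum_eq_single (a * x + b / x - (y ^ q - y))]
      · rw [if_pos]; field_simp; ring
      · intro τ _ hne
        rw [if_neg]
        intro h
        apply hne
        field_simp
        linear_combination -h
      · intro h; exact absurd (mem_univ _) h
    · have hx : x = 0 := by simpa using hx
      refine sum_eq_zero fun y _ => sum_eq_zero fun τ _ => ?_
      rw [if_neg]; rw [hx]; simpa using hb
  have hQ0 : 0 < Q := Fintype.card_pos
  have hM1 : ∑ τ, (M τ : ℝ) = (Q - 1) * Q := by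
    have h := hgen (fun _ => 1)
    simp only [one_mul, sum_const, card_univ, nsmul_eq_mul, mul_one] at h
    rw [filter_ne', card_erase_of_mem (mem_univ _), card_univ, ← hQ, Nat.cast_sub hQ0] at h
    exact_mod_cast h
  have hM2 : ∑ τ, Ψ τ * (M τ : ℂ) = Q * K := by
    rw [hgen, hK, mul_sum]
    refine sum_congr rfl fun x _ => ?_
    have : ∀ y : E, Ψ (a * x + b / x - (y ^ q - y)) = Ψ (a * x + b / x) := by
      intro y
      rw [AddChar.map_sub_eq_div, hΨ, div_one]
    simp only [this, sum_const, card_univ, nsmul_eq_mul, ← hQ]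
  have hsum0 : ∑ τ, Ψ τ = 0 := AddChar.sum_eq_zero_of_ne_one hΨ1
  have h3 : (Q : ℂ) * K = ∑ τ, Ψ τ * ((M τ : ℂ) - (Q + D)) := by
    simp only [mul_sub, sum_sub_distrib, hM2, ← sum_mul, hsum0, zero_mul, sub_zero]
  have h4 : (Q : ℝ) * ‖K‖ ≤ Q * (D + 1) := by
    calc (Q : ℝ) * ‖K‖ = ‖(Q : ℂ) * K‖ := by rw [norm_mul, Complex.norm_natCast]
      _ ≤ ∑ τ, ‖Ψ τ * ((M τ : ℂ) - (Q + D))‖ := by rw [h3]; exact norm_sum_le _ _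
      _ = ∑ τ, ((Q + D : ℝ) - M τ) := by
          refine sum_congr rfl fun τ _ => ?_
          rw [norm_mul, AddChar.norm_apply, one_mul]
          have h5 : (M τ : ℝ) ≤ Q + D := by exact_mod_cast hM τ
          rw [show (M τ : ℂ) - (Q + D) = ((M τ - (Q + D) : ℝ) : ℂ) by push_cast; ring, Complex.norm_real, Real.norm_eq_abs, abs_of_nonpos (by linarith)]
          ring
      _ = Q * (D + 1) := by
          rw [sum_sub_distrib, hM1, sum_const, card_univ, nsmul_eq_mul, ← hQ]; ring
  exact le_of_mul_le_mul_left h4 (by exact_mod_cast hQ0)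

lemma kl_kloosterman {F : Type*} [Field F] [DecidableEq F] [Fintype F] (χ : AddChar F ℂ) (hχ : χ ≠ 1) (a b : F)
    (ha : a ≠ 0) (hb : b ≠ 0) :
    ‖∑ s ∈ univ.filter (fun s : F => s ≠ 0), χ (a*s + b/s)‖ ≤ 2 * √(Fintype.card F : ℝ) := by
  classical
  set q := Fintype.card F with hq
  have hq2 : 2 ≤ q := Fintype.one_lt_card
  apply kl_reduction hχ ha hb (2 * q + 1) 3
  intro k hk
  obtain ⟨p, hp⟩ := CharP.exists F
  haveI := hp
  obtain ⟨r, hpp, hr⟩ := FiniteField.card F p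
  haveI : Fact p.Prime := ⟨hpp⟩
  haveI : NeZero (2 * k) := ⟨by omega⟩
  let E := FiniteField.Extension F p (2 * k)
  letI : Fintype E := Fintype.ofFinite E
  haveI : CharP E p := charP_of_injective_algebraMap (algebraMap F E).injective p
  have hfr : Module.finrank F E = 2 * k := FiniteField.finrank_extension F p (2 * k)
  have hcE : Fintype.card E = (q ^ k) ^ 2 := by
    rw [← Nat.card_eq_fintype_card, FiniteField.natCard_extension, Nat.card_eq_fintype_card, ← pow_mul, mul_comm 2 k]
  have hsum := kl_sum_eq (E := E) χ a b
  rw [hfr] at hsum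
  rw [← hsum]
  let Ψ : AddChar E ℂ := χ.compAddMonoidHom (Algebra.trace F E).toAddMonoidHom
  have hΨa : ∀ z : E, Ψ z = χ (Algebra.trace F E z) := fun z => rfl
  have hΨ1 : Ψ ≠ 1 := by
    intro h
    apply hχ
    ext c
    obtain ⟨z, rfl⟩ := Algebra.trace_surjective F E c
    rw [← hΨa, h]; simp
  have hΨ : ∀ y, Ψ (y ^ q - y) = 1 := by
    intro y
    rw [hΨa, map_sub]
    have := Algebra.trace_eq_of_algEquiv (FiniteField.frobeniusAlgEquivOfAlgebraic F E) y
    rw [FiniteField.coe_frobeniusAlgEquivOfAlgebraic] at this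
    rw [this, sub_self, AddChar.map_zero_eq_one]
  have hinj := (algebraMap F E).injective
  have ha' : algebraMap F E a ≠ 0 := by simpa using ha
  have hb' : algebraMap F E b ≠ 0 := by simpa using hb
  have h := kl_avg Ψ hΨ1 q hΨ (algebraMap F E a) (algebraMap F E b) hb' (2 * q * q ^ k) (by
    intro τ
    rw [hcE]
    refine kl_points _ _ τ ha' hb' q hq2 p (r * k) (q ^ k) (by rw [pow_mul, ← hr]) hcE ?_
    exact Nat.pow_lt_pow_right (by omega) (by omega))
  simp only [hΨa] at h
  refine h.trans ?_
  push_cast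
  have : (1 : ℝ) ≤ (q : ℝ) ^ k := one_le_pow₀ (by exact_mod_cast (by omega : 1 ≤ q))
  linarith
end Avg

section Salie

lemma kl_gauss {F : Type*} [Field F] [Fintype F] [DecidableEq F]
    (hodd : ringChar F ≠ 2) (χ : AddChar F ℂ) (hχ : χ ≠ 1) (c : F) (hc : c ≠ 0) :
    ‖∑ w : F, (quadraticChar F w : ℂ) * χ (c * w)‖ = √(Fintype.card F : ℝ) := by
  have hη : (quadraticChar F).ringHomComp (Int.castRingHom ℂ) ≠ 1 :=
    (MulChar.ringHomComp_ne_one_iff (RingHom.injective_int _)).mpr (quadraticChar_ne_one hodd)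
  have hprim : (χ.mulShift c).IsPrimitive := by
    apply AddChar.IsPrimitive.of_ne_one
    exact (AddChar.IsPrimitive.of_ne_one hχ) hc
  have h := gaussSum_sq hη ((quadraticChar_isQuadratic F).comp (Int.castRingHom ℂ)) hprim
  have h1 : gaussSum ((quadraticChar F).ringHomComp (Int.castRingHom ℂ)) (χ.mulShift c) = ∑ w : F, (quadraticChar F w : ℂ) * χ (c * w) := by
    simp [gaussSum, MulChar.ringHomComp_apply, AddChar.mulShift_apply]
  rw [h1] at h
  have h2 := congrArg norm h
  rw [norm_pow, norm_mul, Complex.norm_natCast] at h2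
  have h3 : ‖(quadraticChar F).ringHomComp (Int.castRingHom ℂ) (-1)‖ = 1 := by
    rw [MulChar.ringHomComp_apply]
    rcases quadraticChar_dichotomy (F := F) (a := -1) (by simp) with h | h <;> rw [h] <;> simp
  rw [h3, one_mul] at h2
  rw [← h2, Real.sqrt_sq (norm_nonneg _)]

lemma kl_salie_fiber {F : Type*} [Field F] [Fintype F] [DecidableEq F]
    (hodd : ringChar F ≠ 2) (v : F) :
    ∑ u ∈ univ.filter (fun u : F => u ≠ 0 ∧ u + 1 / u = v), quadraticChar F u = quadraticChar F (v + 2) + quadraticChar F (v - 2) := by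
  have h2 : (2 : F) ≠ 0 := Ring.two_ne_zero hodd
  have h4 : quadraticChar F 4 = 1 := by
    rw [show (4 : F) = 2 ^ 2 by norm_num]; exact quadraticChar_sq_one' h2
  by_cases hv : v = -2
  · have : univ.filter (fun u : F => u ≠ 0 ∧ u + 1 / u = v) = {-1} := by
      ext u
      simp only [mem_filter, mem_univ, true_and, mem_singleton]
      constructor
      · rintro ⟨hu, h⟩
        rw [hv] at h
        field_simp at h
        have : (u + 1) ^ 2 = 0 := by linear_combination h
        have := pow_eq_zero_iff (two_ne_zero) |>.1 this
        linear_combination this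
      · rintro rfl
        rw [hv]
        refine ⟨by simp, ?_⟩
        rw [div_neg, div_one]; ring
    rw [this, sum_singleton, hv]
    rw [show (-2 : F) + 2 = 0 by ring, show (-2 : F) - 2 = 4 * (-1) by ring, map_mul, h4]
    simp
  · have hv2 : v + 2 ≠ 0 := fun h => hv (by linear_combination h)
    have e1 : ∀ u ∈ univ.filter (fun u : F => u ≠ 0 ∧ u + 1 / u = v), quadraticChar F u = quadraticChar F (v + 2) := by
      intro u hu
      simp only [mem_filter, mem_univ, true_and] at hu
      obtain ⟨hu, h⟩ := hu
      have hu1 : u + 1 ≠ 0 := by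
        intro h'
        apply hv
        rw [← h, show u = -1 by linear_combination h', div_neg, div_one]; ring
      have e : u * (v + 2) = (u + 1) ^ 2 := by
        rw [← h]; field_simp; ring
      have e' := congrArg (quadraticChar F) e
      rw [map_mul, quadraticChar_sq_one' hu1] at e'
      rcases quadraticChar_dichotomy hu with h | h <;> rcases quadraticChar_dichotomy hv2 with h' | h' <;> rw [h, h'] at e' ⊢ <;> simp at e'
    rw [sum_congr rfl e1, sum_const, nsmul_eq_mul]
    have hcard := quadraticChar_card_sqrts hodd (v ^ 2 - 4)
    have e2 : #(univ.filter (fun u : F => u ≠ 0 ∧ u + 1 / u = v)) = #({x : F | x ^ 2 = v ^ 2 - 4}.toFinset) := by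
      apply card_bij (fun u _ => 2 * u - v)
      · intro u hu
        simp only [mem_filter, mem_univ, true_and] at hu
        obtain ⟨hu, h⟩ := hu
        simp only [Set.mem_toFinset, Set.mem_ofPred_eq]
        field_simp at h
        linear_combination 4 * h
      · intro u _ u' _ h
        apply mul_left_cancel₀ h2
        linear_combination h
      · intro x hx
        simp only [Set.mem_toFinset, Set.mem_ofPred_eq] at hx
        have hu : ((x + v) / 2) * ((v - x) / 2) = 1 := by
          field_simp
          linear_combination -hx
        refine ⟨(x + v) / 2, ?_, ?_⟩
        · simp only [mem_filter, mem_univ, true_and]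
          refine ⟨left_ne_zero_of_mul_eq_one hu, ?_⟩
          rw [one_div, inv_eq_of_mul_eq_one_right hu]
          field_simp; ring
        · field_simp; ring
    rw [e2, hcard, show v ^ 2 - 4 = (v + 2) * (v - 2) by ring, map_mul]
    have := quadraticChar_sq_one hv2
    linear_combination (quadraticChar F (v - 2)) * this

lemma kl_salie_one {F : Type*} [Field F] [Fintype F] [DecidableEq F]
    (hodd : ringChar F ≠ 2) (χ : AddChar F ℂ) (c : F) :
    ∑ u ∈ univ.filter (fun u : F => u ≠ 0), (quadraticChar F u : ℂ) * χ (c * (u + 1 / u)) = 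
     (χ (-(2 * c)) + χ (2 * c)) * ∑ w : F, (quadraticChar F w : ℂ) * χ (c * w) := by
  rw [← sum_fiberwise_of_maps_to (t := univ) (g := fun u => u + 1 / u) (by simp)]
  have h1 : ∀ v : F, ∑ u ∈ univ.filter (fun u : F => u ≠ 0) with u + 1 / u = v, (quadraticChar F u : ℂ) * χ (c * (u + 1 / u)) =
     (quadraticChar F (v + 2) : ℂ) * χ (c * v) + (quadraticChar F (v - 2) : ℂ) * χ (c * v) := by
    intro v
    have := kl_salie_fiber hodd v
    have h' := congrArg (fun z : ℤ => (z : ℂ)) this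
    push_cast at h'
    rw [← add_mul, ← h', sum_mul, filter_filter]
    refine sum_congr rfl fun u hu => ?_
    simp only [mem_filter] at hu
    rw [hu.2.2]
  simp only [h1]
  rw [sum_add_distrib, add_mul, mul_sum, mul_sum]
  congr 1
  · rw [← Equiv.sum_comp (Equiv.subRight (2 : F))]
    refine sum_congr rfl fun w _ => ?_
    simp only [Equiv.subRight_apply, sub_add_cancel]
    rw [mul_left_comm, ← AddChar.map_add_eq_mul]
    congr 2; ring
  · rw [← Equiv.sum_comp (Equiv.addRight (2 : F))]
    refine sum_congr rfl fun w _ => ?_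
    simp only [Equiv.coe_addRight, add_sub_cancel_right]
    rw [mul_left_comm, ← AddChar.map_add_eq_mul]
    congr 2; ring

lemma kl_salie {F : Type*} [Field F] [Fintype F] [DecidableEq F]
    (hodd : ringChar F ≠ 2) (χ : AddChar F ℂ) (hχ : χ ≠ 1)
    (a b : F) (ha : a ≠ 0) (hb : b ≠ 0) :
    ‖∑ s ∈ univ.filter (fun s : F => s ≠ 0), (quadraticChar F s : ℂ) * χ (a * s + b / s)‖ ≤ 2 * √(Fintype.card F : ℝ) := by
  set S := ∑ s ∈ univ.filter (fun s : F => s ≠ 0), (quadraticChar F s : ℂ) * χ (a * s + b / s) with hS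
  by_cases hsq : IsSquare (a * b)
  · obtain ⟨c, hc⟩ := hsq
    have hc0 : c ≠ 0 := by
      rintro rfl
      simp [ha, hb] at hc
    have hca : c / a ≠ 0 := div_ne_zero hc0 ha
    have h1 : S = (quadraticChar F (c / a) : ℂ) * ∑ u ∈ univ.filter (fun u : F => u ≠ 0), (quadraticChar F u : ℂ) * χ (c * (u + 1 / u)) := by
      rw [hS, mul_sum]
      symm
      apply sum_bij (fun u _ => c / a * u)
      · intro u hu
        simp only [mem_filter, mem_univ, true_and] at hu ⊢
        exact mul_ne_zero hca hu
      · intro u _ u' _ h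
        exact mul_left_cancel₀ hca h
      · intro s hs
        simp only [mem_filter, mem_univ, true_and] at hs
        refine ⟨s / (c / a), ?_, ?_⟩
        · simp only [mem_filter, mem_univ, true_and]; exact div_ne_zero hs hca
        · field_simp
      · intro u hu
        simp only [mem_filter, mem_univ, true_and] at hu
        rw [map_mul (quadraticChar F)]
        push_cast
        rw [mul_assoc]
        congr 3
        field_simp
        linear_combination -hc
    rw [h1, kl_salie_one hodd, norm_mul, norm_mul, kl_gauss hodd χ hχ c hc0]
    have h2 : ‖(quadraticChar F (c / a) : ℂ)‖ = 1 := by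
      rcases quadraticChar_dichotomy hca with h | h <;> rw [h] <;> simp
    rw [h2, one_mul]
    gcongr
    refine (norm_add_le _ _).trans ?_
    rw [AddChar.norm_apply, AddChar.norm_apply]; norm_num
  · have hη : quadraticChar F (a * b) = -1 := quadraticChar_neg_one_iff_not_isSquare.2 hsq
    have h1 : S = -S := by
      conv_lhs => rw [hS]
      rw [hS, ← sum_neg_distrib]
      apply sum_bij (fun s _ => b / (a * s))
      · intro u hu
        simp only [mem_filter, mem_univ, true_and] at hu ⊢
        exact div_ne_zero hb (mul_ne_zero ha hu)
      · intro u hu u' hu' h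
        simp only [mem_filter, mem_univ, true_and] at hu hu'
        field_simp at h
        exact h.symm
      · intro s hs
        simp only [mem_filter, mem_univ, true_and] at hs
        refine ⟨b / (a * s), ?_, ?_⟩
        · simp only [mem_filter, mem_univ, true_and]; exact div_ne_zero hb (mul_ne_zero ha hs)
        · field_simp
      · intro s hs
        simp only [mem_filter, mem_univ, true_and] at hs
        have e : (b / (a * s)) * (s * a ^ 2) = a * b := by field_simp
        have e' := congrArg (quadraticChar F) e
        rw [map_mul, map_mul, quadraticChar_sq_one' ha, hη, mul_one] at e'
        have e2 : quadraticChar F s = - quadraticChar F (b / (a * s)) := by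
          rcases quadraticChar_dichotomy hs with h | h <;> rw [h] at e' ⊢ <;> linarith
        rw [e2]
        push_cast
        rw [neg_mul]
        congr 3
        field_simp
        ring
    have h0 : S = 0 := by
      have : (2 : ℂ) * S = 0 := by linear_combination h1
      simpa using this
    rw [h0, norm_zero]
    positivity
end Salie

/-- Kloosterman/Salié/Gauss sum estimate: for `a ≠ 0` and any `b`,
`|∑_{s ≠ 0} η(s)^n χ(as + b/s)| ≤ 2√q`. -/
theorem kloosterman_estimate {F : Type*} [Field F] [Fintype F] [DecidableEq F]
    (hodd : ringChar F ≠ 2) (χ : AddChar F ℂ) (hχ : χ ≠ 1)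
    (n : ℕ) (a : F) (ha : a ≠ 0) (b : F) :
    ‖∑ s ∈ Finset.univ.filter (fun s : F => s ≠ 0),
        ((quadraticChar F s : ℂ)) ^ n * χ (a * s + b / s)‖ ≤
      2 * Real.sqrt (Fintype.card F) := by
  have hq1 : 1 ≤ √(Fintype.card F : ℝ) := by
    rw [Real.one_le_sqrt]
    exact_mod_cast Fintype.card_pos
  rcases Nat.even_or_odd n with hn | hn
  · have h1 : ∑ s ∈ Finset.univ.filter (fun s : F => s ≠ 0), ((quadraticChar F s : ℂ)) ^ n * χ (a * s + b / s)
        = ∑ s ∈ Finset.univ.filter (fun s : F => s ≠ 0), χ (a * s + b / s) := by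
      refine sum_congr rfl fun s hs => ?_
      simp only [mem_filter, mem_univ, true_and] at hs
      rcases quadraticChar_dichotomy hs with h | h <;> rw [h] <;> simp [hn.neg_one_pow]
    rw [h1]
    by_cases hb : b = 0
    · have h2 : ∑ s ∈ Finset.univ.filter (fun s : F => s ≠ 0), χ (a * s + b / s) = -1 := by
        have h3 := AddChar.sum_mulShift a (AddChar.IsPrimitive.of_ne_one hχ)
        rw [if_neg ha] at h3
        have h4 := sum_filter_add_sum_filter_not univ (fun s : F => s ≠ 0) (fun s => χ (s * a))
        simp only [h3, not_not, filter_eq', mem_univ, if_true, sum_singleton, zero_mul, AddChar.map_zero_eq_one] at h4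
        simp only [hb, zero_div, add_zero, mul_comm a]
        have h5 : ((0 : ℕ) : ℂ) = 0 := Nat.cast_zero
        linear_combination h4 + h5
      rw [h2, norm_neg, norm_one]
      linarith
    · exact kl_kloosterman χ hχ a b ha hb
  · have h1 : ∑ s ∈ Finset.univ.filter (fun s : F => s ≠ 0), ((quadraticChar F s : ℂ)) ^ n * χ (a * s + b / s)
        = ∑ s ∈ Finset.univ.filter (fun s : F => s ≠ 0), (quadraticChar F s : ℂ) * χ (a * s + b / s) := by
      refine sum_congr rfl fun s hs => ?_
      simp only [mem_filter, mem_univ, true_and] at hs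
      rcases quadraticChar_dichotomy hs with h | h <;> rw [h] <;> simp [hn.neg_one_pow]
    rw [h1]
    by_cases hb : b = 0
    · have h2 : ∑ s ∈ Finset.univ.filter (fun s : F => s ≠ 0), (quadraticChar F s : ℂ) * χ (a * s + b / s)
          = ∑ w : F, (quadraticChar F w : ℂ) * χ (a * w) := by
        rw [sum_filter]
        refine sum_congr rfl fun s _ => ?_
        split_ifs with h
        · simp [hb]
        · have h : s = 0 := by simpa using h
          simp [h]
      rw [h2, kl_gauss hodd χ hχ a ha]
      linarith
    · exact kl_salie hodd χ hχ a b ha hb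
end

section
/- Let F_q be a finite field of odd characteristic and let t ∈ F_q with t ≠ 0. Define σ : F_q^d → ℝ by σ(y) = q if |y|² = t and σ(y) = 0 otherwise. Then for every ξ ∈ F_q^d, the Fourier coefficient σ̂(ξ) = q^{-d} Σ_{x ∈ F_q^d} σ(x) χ(−ξ·x) satisfies |σ̂(ξ) − δ(ξ)| ≤ C q^{(1−d)/2} for an absolute constant C (one may take C = 2), where δ(ξ) = 1 if ξ = 0 and 0 otherwise. -/
open Matrix Finset
open scoped Classical

open Polynomial in
/-- If a combination vanishes then all the coefficients do. -/
lemma stepanov_indep {E : Type*} [Field E] {p e : ℕ} [Fact p.Prime] [CharP E p]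
    (f : E[X]) (hsq : Squarefree f) (hdeg : 0 < f.natDegree) (hf0 : f.coeff 0 ≠ 0)
    (L h : ℕ) (hr : 2 * h = p ^ e + 1) (hL : 2 * L + f.natDegree < p ^ e + 2) (ε : E)
    (hε : ε ^ 2 = 1) (M : ℕ) :
    ∀ (a d : ℕ → E[X]), (∀ j, (a j).degree < L) → (∀ j, (d j).degree < L) →
      ∑ j ∈ range M, (X ^ (p ^ e)) ^ j * (a j + C ε * d j * f ^ h) = 0 →
      ∀ j < M, a j = 0 ∧ d j = 0 := by
  induction M with
  | zero => intro a d _ _ _ j hj; omega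
  | succ M ih =>
    intro a d ha hd hsum
    have hf : f ≠ 0 := by rintro rfl; simp at hdeg
    set r := p ^ e with hrdef
    have h0 : a 0 = 0 ∧ d 0 = 0 := by
      have hdvd : (X : E[X]) ^ r ∣ a 0 + C ε * d 0 * f ^ h := by
        rw [Finset.sum_range_succ'] at hsum
        have h2 : a 0 + C ε * d 0 * f ^ h =
          - ∑ k ∈ range M, (X ^ r) ^ (k + 1) * (a (k + 1) + C ε * d (k + 1) * f ^ h) := by
          rw [eq_neg_iff_add_eq_zero, add_comm]; simpa using hsum
        rw [h2]
        refine (Finset.dvd_sum fun k _ => ?_).neg_right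
        exact Dvd.dvd.mul_right (dvd_pow_self _ (by omega)) _
      have hfr : (X : E[X]) ^ r ∣ f ^ r - C (f.coeff 0 ^ r) := by
        have h1 : (X : E[X]) ∣ f - C (f.coeff 0) := by
          rw [X_dvd_iff]; simp
        have h2 := pow_dvd_pow_of_dvd h1 r
        rwa [hrdef, sub_pow_expChar_pow, ← C_pow] at h2
      have hdvd2 : (X : E[X]) ^ r ∣ a 0 ^ 2 - d 0 ^ 2 * (C (f.coeff 0 ^ r) * f) := by
        have h1 : (a 0 + C ε * d 0 * f ^ h) * (a 0 - C ε * d 0 * f ^ h)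
            = a 0 ^ 2 - d 0 ^ 2 * (f ^ r * f) := by
          have : f ^ r * f = f ^ h * f ^ h := by
            rw [← pow_succ, ← pow_add]; congr 1; omega
          rw [this]
          have h3 : (C ε : E[X]) ^ 2 = 1 := by rw [← C_pow, hε, C_1]
          linear_combination (- d 0 ^ 2 * f ^ h * f ^ h) * h3
        have h2 : a 0 ^ 2 - d 0 ^ 2 * (C (f.coeff 0 ^ r) * f) =
            (a 0 + C ε * d 0 * f ^ h) * (a 0 - C ε * d 0 * f ^ h)
            + (d 0 ^ 2 * f) * (f ^ r - C (f.coeff 0 ^ r)) := by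
          rw [h1]; ring
        rw [h2]
        exact dvd_add (hdvd.mul_right _) (hfr.mul_left _)
      have hc : f.coeff 0 ^ r ≠ 0 := pow_ne_zero _ hf0
      have hz : a 0 ^ 2 - d 0 ^ 2 * (C (f.coeff 0 ^ r) * f) = 0 := by
        apply eq_zero_of_dvd_of_degree_lt hdvd2
        have hLpos : ∀ g : E[X], g.degree < L → (g ^ 2 = 0 ∨ g.natDegree + 1 ≤ L) := by
          intro g hg
          by_cases hg0 : g = 0
          · left; simp [hg0]
          · right; rw [degree_eq_natDegree hg0] at hg; exact_mod_cast hg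
        rw [degree_X_pow]
        refine lt_of_le_of_lt (degree_sub_le _ _) (max_lt ?_ ?_)
        · rcases hLpos _ (ha 0) with h1 | h1
          · rw [h1, degree_zero]; exact WithBot.bot_lt_coe _
          · refine lt_of_le_of_lt degree_le_natDegree ?_
            rw [natDegree_pow]; norm_cast; omega
        · rcases hLpos _ (hd 0) with h1 | h1
          · rw [h1, zero_mul, degree_zero]; exact WithBot.bot_lt_coe _
          · refine lt_of_le_of_lt degree_le_natDegree ?_
            have h3 := natDegree_mul_le (p := d 0 ^ 2) (q := C (f.coeff 0 ^ r) * f)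
            rw [natDegree_pow, natDegree_C_mul hc] at h3
            norm_cast; omega
      rw [sub_eq_zero] at hz
      by_cases hd0 : d 0 = 0
      · rw [hd0] at hz
        refine ⟨?_, hd0⟩
        simpa using hz
      · exfalso
        have h1 : d 0 ∣ a 0 := by
          rw [← IsIntegrallyClosed.pow_dvd_pow_iff (two_ne_zero)]
          exact ⟨_, hz⟩
        obtain ⟨g, hg⟩ := h1
        have h2 : g * g = C (f.coeff 0 ^ r) * f := by
          apply mul_left_cancel₀ (pow_ne_zero 2 hd0)
          rw [← hz, hg]; ring
        have hu : IsUnit (C (f.coeff 0 ^ r) : E[X]) := isUnit_C.2 (isUnit_iff_ne_zero.2 hc)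
        have h3 : g * g ∣ f := by
          rw [h2]; exact (hu.mul_left_dvd).2 dvd_rfl
        have h4 := hsq g h3
        have h5 : IsUnit (C (f.coeff 0 ^ r) * f) := by rw [← h2]; exact h4.mul h4
        have h6 := natDegree_eq_zero_of_isUnit (isUnit_of_mul_isUnit_right h5)
        omega
    have hrest := ih (fun j => a (j + 1)) (fun j => d (j + 1)) (fun j => ha _) (fun j => hd _) (by
      rw [Finset.sum_range_succ'] at hsum
      rw [h0.1, h0.2] at hsum
      have h1 : (X : E[X]) ^ r * ∑ j ∈ range M,
          (X ^ r) ^ j * (a (j + 1) + C ε * d (j + 1) * f ^ h) = 0 := by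
        rw [Finset.mul_sum, ← hsum]
        simp only [mul_zero, zero_mul, add_zero]
        refine Finset.sum_congr rfl fun j _ => ?_
        ring
      exact (mul_eq_zero.1 h1).resolve_left (pow_ne_zero _ X_ne_zero))
    intro j hj
    rcases j with _ | j
    · exact h0
    · exact hrest j (by omega)

open Polynomial in
lemma stepanov_count {E : Type*} [Field E] [Fintype E] {p e : ℕ} [Fact p.Prime] [CharP E p]
    (hcard : Fintype.card E = (p ^ e) ^ 2)
    (f : E[X]) (hsq : Squarefree f) (hdeg : 0 < f.natDegree) (hf0 : f.coeff 0 ≠ 0)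
    (L h M : ℕ) (hr : 2 * h = p ^ e + 1) (hL : 2 * L + f.natDegree < p ^ e + 2) (ε : E)
    (hε : ε = 1 ∨ ε = -1) (hpar : p ^ e * L + f.natDegree * h + M < 2 * (M * L)) :
    (univ.filter fun y : E => f.eval y ^ (p ^ e * h) = ε * f.eval y ^ h).card
      ≤ p ^ e * M + L + f.natDegree * h := by
  set r := p ^ e with hrdef
  have hfrob : ∀ x : E, x ^ r ^ 2 = x := fun x => by rw [← hcard]; exact FiniteField.pow_card x
  have hrodd : Odd r := ⟨h - 1, by omega⟩
  have hεr : ε ^ r = ε := by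
    rcases hε with rfl | rfl
    · simp
    · exact hrodd.neg_one_pow
  have hε2 : ε ^ 2 = 1 := by rcases hε with rfl | rfl <;> simp
  have hrpos : 0 < r := by omega
  -- polynomials from coefficient vectors
  let P : (Fin L → E) → E[X] := fun v => ((degreeLTEquiv E L).symm v : E[X])
  have hPdeg : ∀ v, (P v).degree < L := fun v => mem_degreeLT.1 ((degreeLTEquiv E L).symm v).2
  have hPsub : ∀ v w, P (v - w) = P v - P w := fun v w => by simp [P]
  have hPinj : ∀ v, P v = 0 → v = 0 := fun v hv => by
    have : (degreeLTEquiv E L).symm v = 0 := Subtype.ext hv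
    simpa using this
  let Φ : (Fin M → (Fin L → E) × (Fin L → E)) → E[X] := fun w =>
    ∑ j : Fin M, X ^ (j : ℕ) * (P (w j).1 ^ r + P (w j).2 ^ r * f ^ h)
  have hΦsub : ∀ v w, Φ (v - w) = Φ v - Φ w := fun v w => by
    simp only [Φ, ← Finset.sum_sub_distrib]
    refine Finset.sum_congr rfl fun j _ => ?_
    simp only [Pi.sub_apply, Prod.fst_sub, Prod.snd_sub, hPsub]
    rw [hrdef, sub_pow_expChar_pow, sub_pow_expChar_pow]; ring
  set D := r * L + f.natDegree * h + M with hD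
  have hPnat : ∀ v, (P v ^ r).natDegree ≤ r * L := fun v => by
    rw [natDegree_pow]
    exact Nat.mul_le_mul_left _ (natDegree_le_of_degree_le (hPdeg v).le)
  have hΦdeg : ∀ w, (Φ w).degree < D := fun w => by
    refine lt_of_le_of_lt (degree_sum_le _ _) ?_
    rw [Finset.sup_lt_iff (WithBot.bot_lt_coe _)]
    intro j _
    refine lt_of_le_of_lt degree_le_natDegree ?_
    have h1 : (X ^ (j : ℕ) * (P (w j).1 ^ r + P (w j).2 ^ r * f ^ h)).natDegree
        ≤ (j : ℕ) + (r * L + f.natDegree * h) := by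
      refine natDegree_mul_le.trans (add_le_add (natDegree_X_pow_le _) ?_)
      refine natDegree_add_le_of_degree_le ((hPnat _).trans (by omega)) ?_
      refine natDegree_mul_le.trans (add_le_add (hPnat _) ?_)
      rw [natDegree_pow, mul_comm]
    have := j.2
    norm_cast; omega
  obtain ⟨w1, w2, hne, heq⟩ := Fintype.exists_ne_map_eq_of_card_lt
    (fun w => fun i : Fin D => (Φ w).coeff i) (by
      simp only [Fintype.card_fun, Fintype.card_prod, Fintype.card_fin]
      rw [← pow_add, ← pow_mul]
      exact Nat.pow_lt_pow_right Fintype.one_lt_card (by nlinarith))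
  have hw : Φ (w1 - w2) = 0 := by
    ext i
    by_cases hi : i < D
    · rw [hΦsub, coeff_sub, coeff_zero, sub_eq_zero]
      exact congrFun heq ⟨i, hi⟩
    · rw [coeff_eq_zero_of_degree_lt, coeff_zero]
      exact lt_of_lt_of_le (hΦdeg _) (by exact_mod_cast (not_lt.1 hi))
  have hwne : w1 - w2 ≠ 0 := sub_ne_zero.2 hne
  set w := w1 - w2
  let a : ℕ → E[X] := fun j => if hj : j < M then P (w ⟨j, hj⟩).1 else 0
  let d : ℕ → E[X] := fun j => if hj : j < M then P (w ⟨j, hj⟩).2 else 0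
  have hadeg : ∀ j, (a j).degree < L := fun j => by
    simp only [a]; split_ifs
    · exact hPdeg _
    · rw [degree_zero]; exact WithBot.bot_lt_coe _
  have hddeg : ∀ j, (d j).degree < L := fun j => by
    simp only [d]; split_ifs
    · exact hPdeg _
    · rw [degree_zero]; exact WithBot.bot_lt_coe _
  have hrel : ∑ j ∈ range M, X ^ j * (a j ^ r + d j ^ r * f ^ h) = 0 := by
    rw [Finset.sum_range, ← hw]
    refine Finset.sum_congr rfl fun j _ => ?_
    simp [a, d]
  set U : E[X] := ∑ j ∈ range M, (X ^ r) ^ j * (a j + C ε * d j * f ^ h) with hU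
  have hUne : U ≠ 0 := by
    intro hU0
    have := stepanov_indep f hsq hdeg hf0 L h hr hL ε hε2 M a d hadeg hddeg hU0
    apply hwne
    ext1 j
    have h1 := this j j.2
    simp only [a, d, j.2, dif_pos] at h1
    exact Prod.ext (hPinj _ h1.1) (hPinj _ h1.2)
  have hUdeg : U.natDegree ≤ r * M + L + f.natDegree * h := by
    refine natDegree_sum_le_of_forall_le _ _ fun j hj => ?_
    rw [Finset.mem_range] at hj
    have h1 : ((X : E[X]) ^ r) ^ j = X ^ (r * j) := by rw [pow_mul]
    rw [h1]
    refine natDegree_mul_le.trans ?_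
    have h2 : r * j ≤ r * M := Nat.mul_le_mul_left _ hj.le
    have h3 : (a j + C ε * d j * f ^ h).natDegree ≤ L + f.natDegree * h := by
      refine natDegree_add_le_of_degree_le
        ((natDegree_le_of_degree_le (hadeg j).le).trans (by omega)) ?_
      refine natDegree_mul_le.trans (add_le_add ?_ ?_)
      · exact (natDegree_C_mul_le _ _).trans (natDegree_le_of_degree_le (hddeg j).le)
      · rw [natDegree_pow, mul_comm]
    have h4 := natDegree_X_pow_le (R := E) (r * j)
    omega
  refine le_trans ?_ hUdeg
  refine le_trans ?_ (card_roots' U)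
  refine le_trans ?_ (Multiset.toFinset_card_le _)
  refine Finset.card_le_card fun y hy => ?_
  rw [Finset.mem_filter] at hy
  rw [Multiset.mem_toFinset, mem_roots hUne, IsRoot.def]
  have hpow : U.eval y ^ r = 0 := by
    rw [← eval_pow, hU, hrdef, sum_pow_char_pow, ← hrdef, eval_finsetSum]
    have h1 := congrArg (eval y) hrel
    rw [eval_finsetSum, eval_zero] at h1
    rw [← h1]
    refine Finset.sum_congr rfl fun j _ => ?_
    have hsplit : (a j + C ε * d j * f ^ h) ^ r = a j ^ r + (C ε * d j * f ^ h) ^ r := by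
      rw [hrdef, add_pow_expChar_pow]
    rw [mul_pow, hsplit]
    simp only [eval_mul, eval_pow, eval_add, eval_X, eval_C, mul_pow]
    have e1 : ((y ^ r) ^ j) ^ r = y ^ j := by
      conv_rhs => rw [← hfrob y]
      rw [← pow_mul, ← pow_mul, ← pow_mul]; congr 1; ring
    have e2 : (eval y f ^ h) ^ r = ε * eval y f ^ h := by
      rw [← pow_mul, mul_comm h r, hy.2]
    rw [e1, e2, hεr]
    linear_combination (y ^ j * eval y (d j) ^ r * eval y f ^ h) * hε2
  exact pow_eq_zero_iff (hrpos.ne') |>.1 hpow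

/-- The Kloosterman sum. -/
noncomputable def klSum {E : Type*} [Field E] [Fintype E] (ψ : AddChar E ℂ) (b : E) : ℂ :=
  ∑ x : E, if x = 0 then 0 else ψ (x + b / x)

lemma sum_sq_ite {E : Type*} [Field E] [Fintype E] (h2 : ringChar E ≠ 2) (a : E) :
    (∑ x : E, if x ^ 2 = a then (1 : ℂ) else 0) = 1 + (quadraticChar E a : ℂ) := by
  have h := quadraticChar_card_sqrts h2 a
  have h' : ((univ.filter fun x : E => x ^ 2 = a).card : ℤ) = quadraticChar E a + 1 := by
    rw [← h]; congr 2; ext x; simp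
  rw [Finset.sum_boole]
  have : (((univ.filter fun x : E => x ^ 2 = a).card : ℤ) : ℂ) = ((quadraticChar E a + 1 : ℤ) : ℂ) := by
    rw [h']
  push_cast at this
  rw [this, add_comm]

lemma two_ne_zero_of_ringChar {E : Type*} [Field E] (h2 : ringChar E ≠ 2) : (2 : E) ≠ 0 :=
  Ring.two_ne_zero h2

lemma klSum_eq {E : Type*} [Field E] [Fintype E] (h2 : ringChar E ≠ 2) (ψ : AddChar E ℂ)
    (hψ : ψ ≠ 1) (b : E) (hb : b ≠ 0) :
    klSum ψ b = ∑ u : E, ψ u * (quadraticChar E (u ^ 2 - 4 * b) : ℂ) := by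
  have h20 := two_ne_zero_of_ringChar h2
  have key : ∀ u : E, ψ u * (1 + (quadraticChar E (u ^ 2 - 4 * b) : ℂ)) =
      ∑ x : E, if x ≠ 0 ∧ u = x + b / x then ψ u else 0 := by
    intro u
    rw [← sum_sq_ite h2, Finset.mul_sum]
    symm
    refine Fintype.sum_bijective (fun x : E => 2 * x - u) ?_ _ _ ?_
    · constructor
      · intro x y hxy
        have : 2 * x = 2 * y := by simpa using hxy
        exact mul_left_cancel₀ h20 this
      · intro y
        exact ⟨(y + u) / 2, by field_simp; ring⟩
    · intro x
      have hiff : (x ≠ 0 ∧ u = x + b / x) ↔ (2 * x - u) ^ 2 = u ^ 2 - 4 * b := by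
        constructor
        · rintro ⟨hx, rfl⟩
          field_simp; ring
        · intro h
          have h3 : (2 * 2) * (x * x + b - u * x) = 0 := by linear_combination h
          have h4 : x * x + b - u * x = 0 := by
            rcases mul_eq_zero.1 h3 with h5 | h5
            · exact absurd h5 (mul_ne_zero h20 h20)
            · exact h5
          have hx : x ≠ 0 := by rintro rfl; apply hb; simpa using h4
          refine ⟨hx, ?_⟩
          field_simp; linear_combination -h4
      simp only [hiff]
      split_ifs <;> simp
  have hs : ∑ u : E, ψ u = 0 := AddChar.sum_eq_zero_of_ne_one hψ
  have h1 : ∑ u : E, ψ u * (quadraticChar E (u ^ 2 - 4 * b) : ℂ) =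
      ∑ u : E, ψ u * (1 + (quadraticChar E (u ^ 2 - 4 * b) : ℂ)) := by
    simp only [mul_add, mul_one, Finset.sum_add_distrib, hs, zero_add]
  rw [h1]
  simp_rw [key]
  rw [Finset.sum_comm, klSum]
  refine Finset.sum_congr rfl fun x _ => ?_
  by_cases hx : x = 0
  · simp [hx]
  · simp [hx]

open Polynomial in
lemma hyper_bound {E : Type*} [Field E] [Fintype E] {p e s : ℕ} [Fact p.Prime] [CharP E p]
    (hp2 : p ≠ 2) (hs : 0 < s)
    (hcard : Fintype.card E = (p ^ e) ^ 2) (c b : E) (hb : b ≠ 0) (hc : c ^ 2 - 4 * b ≠ 0)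
    (hbig : 2 * (p ^ s) ^ 2 + 6 * p ^ s + 3 < p ^ e) :
    |∑ y : E, quadraticChar E ((y ^ p ^ s - y + c) ^ 2 - 4 * b)| ≤ 8 * p ^ s * p ^ e := by
  have hchar : ringChar E = p := ringChar.eq E p ▸ rfl
  have h2 : ringChar E ≠ 2 := by rw [hchar]; exact hp2
  have h20 := two_ne_zero_of_ringChar h2
  have hpo : Odd p := (Fact.out : p.Prime).odd_of_ne_two hp2
  have hpp := (Fact.out : p.Prime).two_le
  obtain ⟨n, hn⟩ : Odd (p ^ e) := hpo.pow
  have hq1 : 1 < p ^ s := Nat.one_lt_pow hs.ne' hpp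
  set q := p ^ s with hq
  set r := p ^ e with hrdef
  set g : E[X] := X ^ q - X + C c with hg
  set f : E[X] := g ^ 2 - C (4 * b) with hf
  have heval : ∀ y, f.eval y = (y ^ q - y + c) ^ 2 - 4 * b := fun y => by simp [hf, hg]
  have hgdeg : g.natDegree = q := by
    rw [hg, natDegree_add_C, natDegree_sub_eq_left_of_natDegree_lt]
    · exact natDegree_X_pow q
    · rw [natDegree_X_pow, natDegree_X]; exact hq1
  have hfdeg : f.natDegree = 2 * q := by
    rw [hf, natDegree_sub_C, natDegree_pow, hgdeg]
  have h4b : 4 * b ≠ 0 := by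
    have : (4 : E) = 2 * 2 := by norm_num
    rw [this]; exact mul_ne_zero (mul_ne_zero h20 h20) hb
  have hq0 : (q : E) = 0 := by
    rw [hq]; push_cast; rw [CharP.cast_eq_zero, zero_pow hs.ne']
  have hgd : derivative g = -1 := by
    rw [hg]; simp [derivative_X_pow, hq0]
  have hsep : f.Separable := by
    have hd : derivative f = C (-2) * g := by
      rw [hf]; simp only [derivative_sub, derivative_C, sub_zero, derivative_pow, hgd]
      simp
    refine ⟨C (-(4 * b)⁻¹), C (-(2)⁻¹ * (4 * b)⁻¹) * g, ?_⟩
    rw [hd, hf]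
    have e1 : (C (-(4 * b)⁻¹) : E[X]) * C (4 * b) = -1 := by
      rw [← C_mul]; rw [neg_mul, inv_mul_cancel₀ h4b]; simp
    have e2 : (C (-(2)⁻¹ * (4 * b)⁻¹) : E[X]) * C (-2) = - C (-(4 * b)⁻¹) := by
      rw [← C_mul, ← C_neg]; congr 1; field_simp
    linear_combination (-1 : E[X]) * e1 + g ^ 2 * e2
  have hf0 : f.coeff 0 ≠ 0 := by
    rw [coeff_zero_eq_eval_zero, heval, zero_pow (by omega)]
    simpa using hc
  have hcount : ∀ ε : E, (ε = 1 ∨ ε = -1) →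
      2 * (univ.filter fun y : E => f.eval y ^ (r * (n + 1)) = ε * f.eval y ^ (n + 1)).card
        ≤ r ^ 2 + 8 * q * r := by
    intro ε hε
    obtain ⟨k, hk⟩ : ∃ k, n = q + k := Nat.exists_eq_add_of_le (by nlinarith)
    have h1 := stepanov_count hcard f hsep.squarefree (by omega) hf0 (n - q) (n + 1) (n + q + 2)
      (by omega) (by omega) ε hε (by
        rw [hfdeg, ← hrdef, hn]
        have : n - q = k := by omega
        rw [this]
        subst hk
        nlinarith)
    rw [← hrdef, hfdeg] at h1
    have hk2 : n - q = k := by omega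
    rw [hk2] at h1
    have h3 : 2 * (r * (n + q + 2) + k + 2 * q * (n + 1)) ≤ r ^ 2 + 8 * q * r := by
      rw [hn]; subst hk; nlinarith
    omega
  have hη : ∀ y : E, f.eval y ^ (r * (n + 1)) =
      ((quadraticChar E (f.eval y) : ℤ) : E) * f.eval y ^ (n + 1) := by
    intro y
    rw [quadraticChar_eq_pow_of_char_ne_two' h2, ← pow_add, hcard]
    congr 1
    rw [hn]
    have : (2 * n + 1) ^ 2 = 2 * (2 * n ^ 2 + 2 * n) + 1 := by ring
    rw [this]
    have : (2 * (2 * n ^ 2 + 2 * n) + 1) / 2 = 2 * n ^ 2 + 2 * n := by omega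
    rw [this]; ring
  have hcardZ : (Fintype.card E : ℤ) = r ^ 2 := by rw [hcard]; push_cast; rfl
  have hside : ∀ δ : ℤ, (δ = 1 ∨ δ = -1) →
      δ * ∑ y : E, quadraticChar E (f.eval y) ≤ 8 * q * r := by
    intro δ hδ
    have h1 := hcount (δ : E) (by rcases hδ with rfl | rfl <;> simp)
    have h3 : ∀ y : E, δ * quadraticChar E (f.eval y) ≤
        2 * (if f.eval y ^ (r * (n + 1)) = (δ : E) * f.eval y ^ (n + 1) then 1 else 0) - 1 := by
      intro y
      rw [hη]
      by_cases h0 : f.eval y = 0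
      · simp [h0]
      · rcases quadraticChar_dichotomy h0 with h5 | h5 <;> rw [h5] <;> rcases hδ with rfl | rfl <;>
          split_ifs <;> simp_all
    rw [Finset.mul_sum]
    refine (Finset.sum_le_sum fun y _ => h3 y).trans ?_
    rw [Finset.sum_sub_distrib, ← Finset.mul_sum, Finset.sum_boole]
    simp only [Finset.sum_const, Finset.card_univ, nsmul_eq_mul, mul_one, hcardZ]
    have h6 : (2 * (univ.filter fun y : E =>
      f.eval y ^ (r * (n + 1)) = (δ : E) * f.eval y ^ (n + 1)).card : ℤ) ≤ r ^ 2 + 8 * q * r := by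
      exact_mod_cast h1
    linarith
  simp_rw [← heval]
  have ha := hside 1 (Or.inl rfl)
  have hb := hside (-1) (Or.inr rfl)
  have h7 : ((8 * q * r : ℕ) : ℤ) = 8 * p ^ s * p ^ e := by push_cast [hq, hrdef]; ring
  rw [abs_le]
  push_cast [hq, hrdef] at *
  constructor <;> linarith

lemma klSum_bound {E : Type*} [Field E] [Fintype E] {p e s : ℕ} [Fact p.Prime] [CharP E p]
    (hp2 : p ≠ 2) (hs : 0 < s)
    (hcard : Fintype.card E = (p ^ e) ^ 2) (b : E) (hb : b ≠ 0)
    (hbig : 2 * (p ^ s) ^ 2 + 6 * p ^ s + 3 < p ^ e) (ψ : AddChar E ℂ) (hψ : ψ ≠ 1)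
    (hinv : ∀ y, ψ (y ^ p ^ s) = ψ y) :
    ‖klSum ψ b‖ ≤ 8 * p ^ s * p ^ e + 2 := by
  have hchar : ringChar E = p := ringChar.eq E p ▸ rfl
  have h2 : ringChar E ≠ 2 := by rw [hchar]; exact hp2
  have hQ : (0 : ℝ) < Fintype.card E := by exact_mod_cast Fintype.card_pos
  let S : E → ℤ := fun c => ∑ y : E, quadraticChar E ((y ^ p ^ s - y + c) ^ 2 - 4 * b)
  have h1 : (Fintype.card E : ℂ) * klSum ψ b = ∑ c : E, ψ c * (S c : ℂ) := by
    simp only [S]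
    push_cast
    simp_rw [Finset.mul_sum]
    rw [Finset.sum_comm]
    have : ∀ y : E, ∑ c : E, ψ c *
        (quadraticChar E ((y ^ p ^ s - y + c) ^ 2 - 4 * b) : ℂ) = klSum ψ b := by
      intro y
      rw [klSum_eq h2 ψ hψ b hb]
      refine Fintype.sum_equiv (Equiv.addLeft (y ^ p ^ s - y)) _ _ fun c => ?_
      simp only [Equiv.coe_addLeft]
      rw [AddChar.map_add_eq_mul, AddChar.map_sub_eq_div, hinv, div_self, one_mul]
      intro h0
      have := AddChar.norm_apply ψ y
      rw [h0] at this; simp at this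
    simp_rw [this]
    simp
  have hSb : ∀ c : E, ‖ψ c * (S c : ℂ)‖ ≤ 8 * p ^ s * p ^ e +
      (Fintype.card E : ℝ) * (if c ^ 2 = 4 * b then 1 else 0) := by
    intro c
    rw [norm_mul, AddChar.norm_apply, one_mul, Complex.norm_intCast]
    split_ifs with h
    · have : |(S c : ℝ)| ≤ Fintype.card E := by
        have h3 : |S c| ≤ ∑ y : E, 1 := by
          refine (Finset.abs_sum_le_sum_abs _ _).trans (Finset.sum_le_sum fun y _ => ?_)
          rcases quadraticChar_isQuadratic E ((y ^ p ^ s - y + c) ^ 2 - 4 * b) with h | h | h <;>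
            rw [h] <;> simp
        rw [Finset.sum_const, Finset.card_univ, nsmul_eq_mul, mul_one] at h3
        exact_mod_cast h3
      have h5 : (0 : ℝ) ≤ 8 * p ^ s * p ^ e := by positivity
      linarith
    · have h3 := hyper_bound hp2 hs hcard c b hb (sub_ne_zero.2 h) hbig
      have h4 : |(S c : ℝ)| ≤ 8 * p ^ s * p ^ e := by exact_mod_cast h3
      linarith
  have hcnt : (∑ c : E, if c ^ 2 = 4 * b then (1 : ℝ) else 0) ≤ 2 := by
    have h3 := sum_sq_ite h2 (4 * b)
    have h4 : (∑ c : E, if c ^ 2 = 4 * b then (1 : ℝ) else 0) =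
      1 + (quadraticChar E (4 * b) : ℝ) := by exact_mod_cast h3
    rw [h4]
    rcases quadraticChar_isQuadratic E (4 * b) with h | h | h <;> rw [h] <;> norm_num
  have h5 : (Fintype.card E : ℝ) * ‖klSum ψ b‖ ≤
      (Fintype.card E : ℝ) * (8 * p ^ s * p ^ e + 2) := by
    calc (Fintype.card E : ℝ) * ‖klSum ψ b‖ = ‖(Fintype.card E : ℂ) * klSum ψ b‖ := by
          rw [norm_mul, Complex.norm_natCast]
      _ ≤ ∑ c : E, ‖ψ c * (S c : ℂ)‖ := by rw [h1]; exact norm_sum_le _ _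
      _ ≤ ∑ c : E, (8 * p ^ s * p ^ e +
          (Fintype.card E : ℝ) * (if c ^ 2 = 4 * b then 1 else 0)) :=
          Finset.sum_le_sum fun c _ => hSb c
      _ ≤ _ := by
          rw [Finset.sum_add_distrib, Finset.sum_const, Finset.card_univ, nsmul_eq_mul, mul_add]
          have := mul_le_mul_of_nonneg_left hcnt hQ.le
          rw [Finset.mul_sum] at this
          linarith
  exact le_of_mul_le_mul_left h5 hQ

universe u

/-- Sum over `p` and `u`. -/
lemma sum_kl_pair {E : Type*} [Field E] [Fintype E] (h2 : ringChar E ≠ 2) (ψ : AddChar E ℂ)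
    (hψ : ψ ≠ 1) (b : E) (hb : b ≠ 0) :
    ∑ n : E, ∑ u : E, (if n = 0 then 0 else ψ (2 * u + 2 * u * b / n)) = Fintype.card E := by
  have h20 := two_ne_zero_of_ringChar h2
  have h1 : ∀ n : E, ∑ u : E, (if n = 0 then 0 else ψ (2 * u + 2 * u * b / n)) =
      if n = -b then (Fintype.card E : ℂ) else 0 := by
    intro n
    by_cases hn : n = 0
    · have : ¬ (0 = -b) := fun h => hb (by simpa using h.symm)
      rw [hn, if_neg this]; simp
    · simp only [hn, if_false]
      have h3 := AddChar.sum_mulShift (2 * (n + b) / n) (AddChar.IsPrimitive.of_ne_one hψ)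
      have h4 : ∀ u : E, 2 * u + 2 * u * b / n = u * (2 * (n + b) / n) := fun u => by
        field_simp
      simp_rw [h4]
      rw [h3]
      have h5 : 2 * (n + b) / n = 0 ↔ n = -b := by
        rw [div_eq_zero_iff, mul_eq_zero, eq_neg_iff_add_eq_zero]
        simp [h20, hn]
      simp only [h5]
      split_ifs <;> simp
  simp_rw [h1]
  simp

/-- Collecting the fibres of `u ^ 2 - κ v ^ 2`. -/
lemma sum_fibre {E : Type*} [Field E] [Fintype E] (h2 : ringChar E ≠ 2) (κ : E) (hκ : κ ≠ 0)
    (G : E → E → ℂ) :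
    ∑ u : E, ∑ v : E, G (u ^ 2 - κ * v ^ 2) u =
      ∑ n : E, ∑ u : E, (1 + (quadraticChar E κ : ℂ) * (quadraticChar E (u ^ 2 - n) : ℂ)) * G n u := by
  rw [Finset.sum_comm (s := univ) (t := univ) (f := fun n u =>
    (1 + (quadraticChar E κ : ℂ) * (quadraticChar E (u ^ 2 - n) : ℂ)) * G n u)]
  refine Finset.sum_congr rfl fun u _ => ?_
  have h1 : ∀ n : E, 1 + (quadraticChar E κ : ℂ) * (quadraticChar E (u ^ 2 - n) : ℂ) =
      ∑ v : E, if n = u ^ 2 - κ * v ^ 2 then (1 : ℂ) else 0 := by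
    intro n
    have h3 := sum_sq_ite h2 ((u ^ 2 - n) * κ⁻¹)
    have h4 : quadraticChar E κ⁻¹ = quadraticChar E κ := by
      have h5 : quadraticChar E κ⁻¹ * quadraticChar E κ = 1 := by
        rw [← map_mul, inv_mul_cancel₀ hκ, map_one]
      rcases quadraticChar_dichotomy hκ with h | h <;> rw [h] at h5 ⊢ <;> linarith
    rw [map_mul, h4] at h3
    push_cast at h3
    rw [mul_comm (quadraticChar E κ : ℂ), ← h3]
    refine Finset.sum_congr rfl fun v _ => ?_
    have : v ^ 2 = (u ^ 2 - n) * κ⁻¹ ↔ n = u ^ 2 - κ * v ^ 2 := by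
      rw [← div_eq_mul_inv, eq_div_iff hκ]
      constructor
      · intro h; linear_combination h
      · intro h; linear_combination h
    simp only [this]
  simp_rw [h1, Finset.sum_mul]
  rw [Finset.sum_comm]
  refine Finset.sum_congr rfl fun v _ => ?_
  simp

lemma klSum_sq {E : Type*} [Field E] [Fintype E] (h2 : ringChar E ≠ 2) (ψ : AddChar E ℂ)
    (b : E) :
    klSum ψ b ^ 2 = ∑ u : E, ∑ v : E,
      (if u ^ 2 - 1 * v ^ 2 = 0 then 0 else ψ (2 * u + 2 * u * b / (u ^ 2 - 1 * v ^ 2))) := by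
  have h20 := two_ne_zero_of_ringChar h2
  rw [sq, klSum, Finset.sum_mul_sum, ← Finset.sum_product', ← Finset.sum_product']
  symm
  refine Finset.sum_bij' (fun z _ => (z.1 + z.2, z.1 - z.2))
    (fun z _ => ((z.1 + z.2) / 2, (z.1 - z.2) / 2)) (by simp) (by simp) ?_ ?_ ?_
  · rintro ⟨u, v⟩ _; ext <;> simp <;> field_simp <;> ring
  · rintro ⟨u, v⟩ _; ext <;> simp <;> field_simp <;> ring
  · rintro ⟨u, v⟩ _
    have hfac : u ^ 2 - 1 * v ^ 2 = (u + v) * (u - v) := by ring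
    simp only [hfac]
    by_cases ha : u + v = 0
    · simp [ha]
    · by_cases hb : u - v = 0
      · simp [hb]
      · simp only [ha, hb, mul_eq_zero, or_self, if_false]
        rw [← AddChar.map_add_eq_mul]
        congr 1
        field_simp
        ring

lemma quad_step {E : Type u} [Field E] [Fintype E] {p s : ℕ} [Fact p.Prime] [CharP E p]
    (hp2 : p ≠ 2) (b : E) (hb : b ≠ 0) (ψ : AddChar E ℂ) (hψ : ψ ≠ 1)
    (hinv : ∀ y, ψ (y ^ p ^ s) = ψ y) :
    ∃ (E' : Type u) (_ : Field E') (_ : Fintype E') (_ : CharP E' p) (b' : E')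
      (ψ' : AddChar E' ℂ), b' ≠ 0 ∧ ψ' ≠ 1 ∧ (∀ y, ψ' (y ^ p ^ s) = ψ' y) ∧
      Fintype.card E' = Fintype.card E ^ 2 ∧
      klSum ψ' b' = 2 * Fintype.card E - klSum ψ b ^ 2 := by
  have hchar : ringChar E = p := ringChar.eq E p ▸ rfl
  have h2 : ringChar E ≠ 2 := by rw [hchar]; exact hp2
  have h20 := two_ne_zero_of_ringChar h2
  obtain ⟨δ, hδ⟩ := FiniteField.exists_nonsquare h2
  have hδ0 : δ ≠ 0 := by rintro rfl; exact hδ (IsSquare.zero)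
  have : Fact (∀ x : E, x ^ 2 ≠ δ + 0 * x) := ⟨fun x hx => hδ ⟨x, by rw [← sq, hx]; ring⟩⟩
  let E' := QuadraticAlgebra E δ 0
  let eqv : E' ≃ E × E := QuadraticAlgebra.equivProd δ 0
  let : Fintype E' := Fintype.ofEquiv _ eqv.symm
  have hCP : CharP E' p := charP_of_injective_algebraMap (algebraMap E E').injective p
  let tr : E' →+ E := (QuadraticAlgebra.trace : E' →ₗ[E] E).toAddMonoidHom
  have htr : ∀ z : E', tr z = 2 * z.re := fun z => by
    change QuadraticAlgebra.trace z = _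
    rw [QuadraticAlgebra.trace_def]; ring
  let ψ' : AddChar E' ℂ := ψ.compAddMonoidHom tr
  have hψ' : ∀ z, ψ' z = ψ (2 * z.re) := fun z => by
    change ψ (tr z) = _
    rw [htr]
  refine ⟨E', inferInstance, inferInstance, hCP, algebraMap E E' b, ψ', ?_, ?_, ?_, ?_, ?_⟩
  · simpa using hb
  · intro h
    apply hψ
    ext x
    have h1 := hψ' (algebraMap E E' (x / 2))
    rw [h] at h1
    have h3 : (algebraMap E E' (x / 2)).re = x / 2 := rfl
    rw [h3] at h1
    rw [mul_div_cancel₀ _ h20] at h1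
    simpa using h1.symm
  · intro z
    have h1 : tr (z ^ p ^ s) = (tr z) ^ p ^ s := by
      apply (algebraMap E E').injective
      rw [map_pow (algebraMap E E')]
      change algebraMap E E' (QuadraticAlgebra.trace (z ^ p ^ s)) =
        algebraMap E E' (QuadraticAlgebra.trace z) ^ p ^ s
      rw [QuadraticAlgebra.algebraMap_trace_eq_add_star,
        QuadraticAlgebra.algebraMap_trace_eq_add_star, star_pow, add_pow_expChar_pow]
    change ψ (tr (z ^ p ^ s)) = ψ (tr z)
    rw [h1, hinv]
  · rw [Fintype.card_congr eqv, Fintype.card_prod, sq]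
  · have hK : klSum ψ' (algebraMap E E' b) = ∑ u : E, ∑ v : E,
        (if u ^ 2 - δ * v ^ 2 = 0 then 0 else ψ (2 * u + 2 * u * b / (u ^ 2 - δ * v ^ 2))) := by
      rw [klSum, ← Finset.sum_product']
      refine Fintype.sum_equiv eqv _ _ fun z => ?_
      have hn : QuadraticAlgebra.norm z = z.re ^ 2 - δ * z.im ^ 2 := by
        rw [QuadraticAlgebra.norm_def]; ring
      have hz : z = 0 ↔ z.re ^ 2 - δ * z.im ^ 2 = 0 := by
        rw [← hn, QuadraticAlgebra.norm_eq_zero_iff_eq_zero]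
      change _ = if z.re ^ 2 - δ * z.im ^ 2 = 0 then 0
        else ψ (2 * z.re + 2 * z.re * b / (z.re ^ 2 - δ * z.im ^ 2))
      simp only [hz]
      split_ifs with h0
      · rfl
      · rw [hψ']
        congr 1
        have : (z + algebraMap E E' b / z).re =
          z.re + b * ((z.re ^ 2 - δ * z.im ^ 2)⁻¹ * z.re) := by
          rw [QuadraticAlgebra.re_add, div_eq_mul_inv, QuadraticAlgebra.re_mul]
          rw [QuadraticAlgebra.algebraMap_re, QuadraticAlgebra.algebraMap_im]
          have hi : (z⁻¹).re = (z.re ^ 2 - δ * z.im ^ 2)⁻¹ * z.re := by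
            change ((QuadraticAlgebra.norm z)⁻¹ • star z).re = _
            rw [QuadraticAlgebra.re_smul, QuadraticAlgebra.re_star, hn]; simp
          rw [hi]; ring
        rw [this]
        field_simp
    have hδη : (quadraticChar E δ : ℂ) = -1 := by
      rw [quadraticChar_neg_one_iff_not_isSquare.2 hδ]; simp
    let G : E → E → ℂ := fun n u => if n = 0 then 0 else ψ (2 * u + 2 * u * b / n)
    have e1 := sum_fibre h2 δ hδ0 G
    have e2 := sum_fibre h2 1 one_ne_zero G
    have e3 := klSum_sq h2 ψ b
    have e4 := sum_kl_pair h2 ψ hψ b hb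
    rw [eq_sub_iff_add_eq, hK, e3]
    change (∑ u : E, ∑ v : E, G (u ^ 2 - δ * v ^ 2) u) +
      (∑ u : E, ∑ v : E, G (u ^ 2 - 1 * v ^ 2) u) = _
    rw [e1, e2, hδη, ← e4, Finset.mul_sum, ← Finset.sum_add_distrib]
    refine Finset.sum_congr rfl fun n _ => ?_
    rw [Finset.mul_sum, ← Finset.sum_add_distrib]
    refine Finset.sum_congr rfl fun u _ => ?_
    simp only [map_one, G]
    push_cast
    ring

lemma tower {F : Type u} [Field F] [Fintype F] {p s : ℕ} [Fact p.Prime] [CharP F p]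
    (hp2 : p ≠ 2) (hcard : Fintype.card F = p ^ s) (b : F) (hb : b ≠ 0) (ψ : AddChar F ℂ)
    (hψ : ψ ≠ 1) (η : ℝ) (hη : 0 ≤ η)
    (hbig : (4 + η) * Fintype.card F ≤ ‖klSum ψ b‖ ^ 2) (k : ℕ) :
    ∃ (E : Type u) (_ : Field E) (_ : Fintype E) (_ : CharP E p) (b' : E)
      (ψ' : AddChar E ℂ), b' ≠ 0 ∧ ψ' ≠ 1 ∧ (∀ y, ψ' (y ^ p ^ s) = ψ' y) ∧
      Fintype.card E = Fintype.card F ^ 2 ^ k ∧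
      (4 + 4 ^ k * η) * Fintype.card E ≤ ‖klSum ψ' b'‖ ^ 2 := by
  induction k with
  | zero =>
    refine ⟨F, inferInstance, inferInstance, inferInstance, b, ψ, hb, hψ, ?_, by simp, by simpa⟩
    intro y
    rw [← hcard, FiniteField.pow_card]
  | succ k ih =>
    obtain ⟨E, _, _, _, b', ψ', hb', hψ', hinv, hc, hK⟩ := ih
    obtain ⟨E2, i1, i2, i3, b2, ψ2, hb2, hψ2, hinv2, hc2, hK2⟩ :=
      quad_step hp2 b' hb' ψ' hψ' hinv
    refine ⟨E2, i1, i2, i3, b2, ψ2, hb2, hψ2, hinv2, ?_, ?_⟩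
    · rw [hc2, hc, ← pow_mul, pow_succ]
    · have h1 : ‖klSum ψ' b'‖ ^ 2 - 2 * Fintype.card E ≤ ‖klSum ψ2 b2‖ := by
        rw [hK2]
        have := norm_sub_norm_le (klSum ψ' b' ^ 2) (2 * (Fintype.card E : ℂ))
        rw [norm_pow, norm_mul, Complex.norm_natCast, Complex.norm_ofNat, norm_sub_rev] at this
        exact this
      have h2 : (2 + 4 ^ k * η) * Fintype.card E ≤ ‖klSum ψ2 b2‖ := by linarith
      have h3 : (0 : ℝ) ≤ 4 ^ k * η := by positivity
      have h4 : (0 : ℝ) ≤ (2 + 4 ^ k * η) * Fintype.card E := by positivity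
      have h5 := pow_le_pow_left₀ h4 h2 2
      refine le_trans ?_ h5
      rw [hc2, pow_succ, mul_pow]
      push_cast
      gcongr
      nlinarith

/-- The Weil bound for Kloosterman sums over a finite field of odd characteristic. -/
theorem weil_kloosterman {F : Type u} [Field F] [Fintype F] (h2 : ringChar F ≠ 2) (b : F)
    (hb : b ≠ 0) (ψ : AddChar F ℂ) (hψ : ψ ≠ 1) :
    ‖klSum ψ b‖ ^ 2 ≤ 4 * Fintype.card F := by
  by_contra hcon
  push Not at hcon
  obtain ⟨p, hpc⟩ := CharP.exists F
  obtain ⟨s, hpp, hcard⟩ := FiniteField.card F p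
  have := Fact.mk hpp
  have hp2 : p ≠ 2 := by rw [ringChar.eq F p] at h2; exact h2
  have hQ : (0 : ℝ) < Fintype.card F := by exact_mod_cast Fintype.card_pos
  set η : ℝ := ‖klSum ψ b‖ ^ 2 / Fintype.card F - 4 with hη
  have hη0 : 0 < η := by
    rw [hη, sub_pos, lt_div_iff₀ hQ]; exact hcon
  have hstart : (4 + η) * Fintype.card F ≤ ‖klSum ψ b‖ ^ 2 := by
    rw [hη, add_sub_cancel, div_mul_cancel₀ _ hQ.ne']
  obtain ⟨k, hk⟩ := pow_unbounded_of_one_lt ((10 * (p : ℝ) ^ (s : ℕ)) ^ 2 / η)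
    (by norm_num : (1 : ℝ) < 4)
  obtain ⟨E, _, _, _, b', ψ', hb', hψ', hinv, hc, hK⟩ :=
    tower hp2 hcard b hb ψ hψ η hη0.le hstart (k + 3)
  set q := p ^ (s : ℕ) with hq
  have hq3 : 3 ≤ q := by
    have h3 : 3 ≤ p := by have := hpp.two_le; omega
    exact h3.trans (Nat.le_self_pow s.pos.ne' p)
  have hcE : Fintype.card E = (p ^ ((s : ℕ) * 2 ^ (k + 2))) ^ 2 := by
    rw [hc, hcard, hq, ← pow_mul, ← pow_mul]; congr 1; ring
  have hre : p ^ ((s : ℕ) * 2 ^ (k + 2)) = q ^ 2 ^ (k + 2) := by rw [pow_mul]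
  have hr4 : q ^ 4 ≤ p ^ ((s : ℕ) * 2 ^ (k + 2)) := by
    rw [hre]
    apply Nat.pow_le_pow_right (by omega)
    have := Nat.one_le_two_pow (n := k)
    rw [pow_add]; omega
  have h9 : 9 ≤ q ^ 2 := by nlinarith
  have hbig : 2 * (p ^ (s : ℕ)) ^ 2 + 6 * p ^ (s : ℕ) + 3 < p ^ ((s : ℕ) * 2 ^ (k + 2)) := by
    refine lt_of_lt_of_le ?_ hr4
    rw [← hq]
    have : q ^ 4 = q ^ 2 * q ^ 2 := by ring
    rw [this]
    nlinarith
  have hB := klSum_bound hp2 s.pos hcE b' hb' hbig ψ' hψ' hinv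
  set r := p ^ ((s : ℕ) * 2 ^ (k + 2)) with hr
  have hr1 : 1 ≤ r := by omega
  have hB' : ‖klSum ψ' b'‖ ≤ 10 * q * r := by
    have e1 : (8 * (p : ℝ) ^ (s : ℕ) * (p : ℝ) ^ ((s : ℕ) * 2 ^ (k + 2)) + 2) =
      ((8 * q * r + 2 : ℕ) : ℝ) := by push_cast [hq, hr]; ring
    rw [e1] at hB
    refine hB.trans ?_
    have : 8 * q * r + 2 ≤ 10 * q * r := by nlinarith [Nat.mul_le_mul hq3 hr1]
    exact_mod_cast this
  have hB2 := pow_le_pow_left₀ (norm_nonneg _) hB' 2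
  have h5 := hK.trans hB2
  have hcER : (Fintype.card E : ℝ) = (r : ℝ) ^ 2 := by rw [hcE]; push_cast; rfl
  rw [hcER, mul_pow (10 * (q : ℝ))] at h5
  have hrpos : (0 : ℝ) < (r : ℝ) ^ 2 := by positivity
  have h6 := le_of_mul_le_mul_right h5 hrpos
  rw [div_lt_iff₀ hη0] at hk
  have h7 : (10 * (q : ℝ)) ^ 2 < 4 ^ k * η := by
    have : (q : ℝ) = (p : ℝ) ^ (s : ℕ) := by push_cast [hq]; rfl
    rw [this]; exact hk
  have h8 : (4 : ℝ) ^ k * η ≤ 4 ^ (k + 3) * η := by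
    gcongr <;> norm_num
  linarith

/-- The complex valued quadratic character. -/
noncomputable def qchar (F : Type*) [Field F] [Fintype F] : MulChar F ℂ :=
  (quadraticChar F).ringHomComp (Int.castRingHom ℂ)

lemma qchar_apply {F : Type*} [Field F] [Fintype F] (a : F) :
    qchar F a = (quadraticChar F a : ℂ) := rfl

lemma qchar_sq {F : Type*} [Field F] [Fintype F] {a : F} (ha : a ≠ 0) : qchar F a ^ 2 = 1 := by
  rw [qchar_apply]; exact_mod_cast quadraticChar_sq_one ha

lemma qchar_norm {F : Type*} [Field F] [Fintype F] {a : F} (ha : a ≠ 0) : ‖qchar F a‖ = 1 := by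
  rw [qchar_apply]
  rcases quadraticChar_dichotomy ha with h | h <;> rw [h] <;> simp

lemma gauss_norm_sq {F : Type*} [Field F] [Fintype F] (h2 : ringChar F ≠ 2) (χ : AddChar F ℂ)
    (hχ : χ ≠ 1) : ‖gaussSum (qchar F) χ‖ ^ 2 = Fintype.card F := by
  have hne : qchar F ≠ 1 := by
    obtain ⟨a, ha⟩ := quadraticChar_exists_neg_one' h2
    intro h
    have h1 := qchar_apply (a : F)
    rw [h, ha, MulChar.one_apply a.isUnit] at h1
    norm_num at h1
  have hq : (qchar F).IsQuadratic := (quadraticChar_isQuadratic F).comp _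
  have h := gaussSum_sq hne hq (AddChar.IsPrimitive.of_ne_one hχ)
  rw [← norm_pow, h, norm_mul, qchar_norm (by simp), one_mul, Complex.norm_natCast]

lemma gauss_shift {F : Type*} [Field F] [Fintype F] (χ : AddChar F ℂ) {s : F} (hs : s ≠ 0) :
    ∑ a : F, qchar F a * χ (s * a) = qchar F s * gaussSum (qchar F) χ := by
  have h := gaussSum_mulShift (qchar F) χ (Units.mk0 s hs)
  rw [← h, ← mul_assoc, Units.val_mk0, ← sq, qchar_sq hs, one_mul]
  rfl

lemma quad_sum {F : Type*} [Field F] [Fintype F] (h2 : ringChar F ≠ 2) (χ : AddChar F ℂ)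
    (hχ : χ ≠ 1) {s : F} (hs : s ≠ 0) (c : F) :
    ∑ x : F, χ (s * x ^ 2 - c * x) =
      χ (-(c ^ 2 / 4 / s)) * (qchar F s * gaussSum (qchar F) χ) := by
  have h20 := two_ne_zero_of_ringChar h2
  have h40 : (4 : F) ≠ 0 := by
    have : (4 : F) = 2 * 2 := by norm_num
    rw [this]; exact mul_ne_zero h20 h20
  have h1 : ∑ x : F, χ (s * x ^ 2 - c * x) = ∑ x : F, χ (-(c ^ 2 / 4 / s)) * χ (s * x ^ 2) := by
    refine Fintype.sum_equiv (Equiv.addRight (-(c / (2 * s)))) _ _ fun x => ?_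
    rw [← AddChar.map_add_eq_mul]
    congr 1
    simp only [Equiv.coe_addRight]
    have : (4 : F) = 2 * 2 := by norm_num
    rw [this]
    field_simp
    ring
  rw [h1, ← Finset.mul_sum, ← gauss_shift χ hs]
  congr 1
  have h3 : ∀ x : F, χ (s * x ^ 2) = ∑ a : F, (if x ^ 2 = a then (1 : ℂ) else 0) * χ (s * a) := by
    intro x; simp
  simp_rw [h3]
  rw [Finset.sum_comm]
  simp_rw [← Finset.sum_mul, sum_sq_ite h2, add_mul, one_mul, Finset.sum_add_distrib]
  have h4 : ∑ a : F, χ (s * a) = 0 := by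
    have := AddChar.sum_mulShift s (AddChar.IsPrimitive.of_ne_one hχ)
    rw [if_neg hs] at this
    simp_rw [mul_comm s]
    simpa using this
  rw [h4, zero_add]
  rfl

lemma salie_bound {F : Type*} [Field F] [Fintype F] (h2 : ringChar F ≠ 2) (χ : AddChar F ℂ)
    (hχ : χ ≠ 1) {a b : F} (ha : a ≠ 0) (hb : b ≠ 0) :
    ‖∑ s : F, qchar F s * χ (a * s + b / s)‖ ^ 2 ≤ 4 * Fintype.card F := by
  have h20 := two_ne_zero_of_ringChar h2
  set T := ∑ s : F, qchar F s * χ (a * s + b / s) with hT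
  have hQ : (0 : ℝ) < Fintype.card F := by exact_mod_cast Fintype.card_pos
  by_cases hsq : IsSquare (a * b)
  · obtain ⟨k, hk⟩ := hsq
    set g := gaussSum (qchar F) χ with hg
    have hgn : ‖g‖ ^ 2 = Fintype.card F := gauss_norm_sq h2 χ hχ
    set T' := ∑ s : F, qchar F s * χ (-(k ^ 2) * s - 1 / s) with hT'
    have h1 : T = qchar F (-b) * T' := by
      rw [hT, hT', Finset.mul_sum]
      symm
      refine Fintype.sum_bijective (fun s : F => (-b) * s) (mulLeft_bijective₀ (-b) (neg_ne_zero.2 hb)) _ _ fun s => ?_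
      rw [← mul_assoc, ← map_mul]
      congr 2
      by_cases hs : s = 0
      · simp [hs]
      · field_simp
        linear_combination (s ^ 2) * hk
    have h3 : T' * g = Fintype.card F * ∑ x : F, (if x ^ 2 = k ^ 2 then χ (-(2 * x)) else 0) := by
      have e1 : ∀ s : F, qchar F s * χ (-(k ^ 2) * s - 1 / s) * g =
          (∑ x : F, χ (s * (x ^ 2 - k ^ 2)) * χ (-(2 * x))) -
            (if s = 0 then ∑ x : F, χ (-(2 * x)) else 0) := by
        intro s
        by_cases hs : s = 0
        · simp [hs, qchar_apply]
        · have e2 := quad_sum h2 χ hχ hs 2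
          have e3 : ∀ x : F, χ (s * (x ^ 2 - k ^ 2)) * χ (-(2 * x)) =
              χ (-(k ^ 2) * s) * χ (s * x ^ 2 - 2 * x) := fun x => by
            rw [← AddChar.map_add_eq_mul, ← AddChar.map_add_eq_mul]; congr 1; ring
          simp_rw [e3, if_neg hs, sub_zero, ← Finset.mul_sum]
          have h40 : (4 : F) ≠ 0 := by
            have : (4 : F) = 2 * 2 := by norm_num
            rw [this]; exact mul_ne_zero h20 h20
          have h41 : (2 : F) ^ 2 / 4 = 1 := by
            rw [div_eq_one_iff_eq h40]; norm_num
          rw [e2, h41, sub_eq_add_neg, AddChar.map_add_eq_mul]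
          ring
      have e4 : ∑ x : F, χ (-(2 * x)) = 0 := by
        have := AddChar.sum_mulShift (-2 : F) (AddChar.IsPrimitive.of_ne_one hχ)
        rw [if_neg (neg_ne_zero.2 h20)] at this
        have e5 : ∀ x : F, -(2 * x) = x * -2 := fun x => by ring
        simp_rw [e5]
        simpa using this
      rw [hT', Finset.sum_mul]
      simp_rw [e1, e4, ite_self, sub_zero]
      rw [Finset.sum_comm, Finset.mul_sum]
      refine Finset.sum_congr rfl fun x _ => ?_
      rw [← Finset.sum_mul, AddChar.sum_mulShift _ (AddChar.IsPrimitive.of_ne_one hχ)]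
      simp only [sub_eq_zero]
      split_ifs <;> simp
    have h4 : ‖∑ x : F, (if x ^ 2 = k ^ 2 then χ (-(2 * x)) else 0)‖ ≤ 2 := by
      have e1 : ∀ x : F, ‖(if x ^ 2 = k ^ 2 then χ (-(2 * x)) else 0)‖ =
          (if x ^ 2 = k ^ 2 then (1 : ℝ) else 0) := fun x => by
        split_ifs <;> simp
      refine (norm_sum_le _ _).trans ?_
      simp_rw [e1]
      have h3 := sum_sq_ite h2 (k ^ 2)
      have h4 : (∑ c : F, if c ^ 2 = k ^ 2 then (1 : ℝ) else 0) =
        1 + (quadraticChar F (k ^ 2) : ℝ) := by exact_mod_cast h3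
      rw [h4]
      rcases quadraticChar_isQuadratic F (k ^ 2) with h | h | h <;> rw [h] <;> norm_num
    have h5 : ‖T‖ * ‖g‖ ≤ Fintype.card F * 2 := by
      rw [h1, norm_mul, qchar_norm (neg_ne_zero.2 hb), one_mul, ← norm_mul, h3, norm_mul,
        Complex.norm_natCast]
      gcongr
    have h6 := pow_le_pow_left₀ (by positivity) h5 2
    rw [mul_pow, hgn] at h6
    have h7 : ‖T‖ ^ 2 * Fintype.card F ≤ (4 * Fintype.card F) * Fintype.card F := by
      linarith
    exact le_of_mul_le_mul_right h7 hQ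
  · have hη : qchar F (a * b) = -1 := by
      rw [qchar_apply, quadraticChar_neg_one_iff_not_isSquare.2 hsq]; simp
    have hab : qchar F (b / a) = -1 := by
      have : a * b = (b / a) * a ^ 2 := by field_simp
      rw [this, map_mul, map_pow, qchar_sq ha, mul_one] at hη
      exact hη
    have h1 : T = - T := by
      conv_rhs => rw [hT]
      rw [← Finset.sum_neg_distrib, hT]
      refine Fintype.sum_bijective (fun s : F => (b / a) * s⁻¹) ?_ _ _ fun s => ?_
      · exact (mulLeft_bijective₀ (b / a) (div_ne_zero hb ha)).comp inv_involutive.bijective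
      · rw [map_mul, hab]
        by_cases hs : s = 0
        · simp [hs]
        · have e1 : qchar F s⁻¹ = qchar F s := by
            have : s⁻¹ = s * (s⁻¹) ^ 2 := by field_simp
            rw [this, map_mul, map_pow, qchar_sq (inv_ne_zero hs), mul_one]
          rw [e1]
          have e2 : a * (b / a * s⁻¹) + b / (b / a * s⁻¹) = a * s + b / s := by
            field_simp; ring
          rw [e2]; ring
    have h3 : T = 0 := self_eq_neg.1 h1
    rw [h3]; simp

lemma twisted_bound {F : Type u} [Field F] [Fintype F] (h2 : ringChar F ≠ 2) (χ : AddChar F ℂ)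
    (hχ : χ ≠ 1) {a : F} (ha : a ≠ 0) (b : F) (n : ℕ) :
    ‖∑ s : F, if s = 0 then 0 else qchar F s ^ n * χ (a * s + b / s)‖ ^ 2
      ≤ 4 * Fintype.card F := by
  have hQ : (1 : ℝ) ≤ Fintype.card F := by exact_mod_cast Fintype.card_pos
  rcases Nat.even_or_odd' n with ⟨m, rfl | rfl⟩
  · have h1 : (∑ s : F, if s = 0 then 0 else qchar F s ^ (2 * m) * χ (a * s + b / s)) =
        ∑ s : F, if s = 0 then 0 else χ (a * s + b / s) := by
      refine Finset.sum_congr rfl fun s _ => ?_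
      split_ifs with hs
      · rfl
      · rw [pow_mul, qchar_sq hs, one_pow, one_mul]
    rw [h1]
    by_cases hb : b = 0
    · subst hb
      have h3 : (∑ s : F, if s = 0 then 0 else χ (a * s + 0 / s)) = -1 := by
        have e1 : ∀ s : F, (if s = 0 then 0 else χ (a * s + 0 / s)) =
            χ (s * a) - (if s = 0 then 1 else 0) := fun s => by
          by_cases hs : s = 0
          · simp [hs]
          · simp [hs, mul_comm]
        simp_rw [e1]
        rw [Finset.sum_sub_distrib, AddChar.sum_mulShift _ (AddChar.IsPrimitive.of_ne_one hχ),
          if_neg ha]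
        simp
      rw [h3]; simp; linarith
    · have h3 : (∑ s : F, if s = 0 then 0 else χ (a * s + b / s)) = klSum χ (a * b) := by
        rw [klSum]
        refine Fintype.sum_bijective (fun s : F => a * s) (mulLeft_bijective₀ a ha) _ _ fun s => ?_
        by_cases hs : s = 0
        · simp [hs]
        · simp only [hs, mul_eq_zero, ha, or_self, if_false]
          rw [mul_div_mul_left _ _ ha]
      rw [h3]
      exact weil_kloosterman h2 (a * b) (mul_ne_zero ha hb) χ hχ
  · have h1 : (∑ s : F, if s = 0 then 0 else qchar F s ^ (2 * m + 1) * χ (a * s + b / s)) =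
        ∑ s : F, qchar F s * χ (a * s + b / s) := by
      refine Finset.sum_congr rfl fun s _ => ?_
      split_ifs with hs
      · rw [hs, qchar_apply]; simp
      · rw [pow_succ, pow_mul, qchar_sq hs, one_pow, one_mul]
    rw [h1]
    by_cases hb : b = 0
    · subst hb
      simp only [zero_div, add_zero]
      rw [gauss_shift χ ha, norm_mul, qchar_norm ha, one_mul, gauss_norm_sq h2 χ hχ]
      linarith
    · exact salie_bound h2 χ hχ ha hb

lemma sphere_expand {F : Type*} [Field F] [Fintype F]
    (h2 : ringChar F ≠ 2) (χ : AddChar F ℂ) (hχ : χ ≠ 1)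
    (d : ℕ) (t : F) (ξ : Fin d → F) :
    (∑ x : Fin d → F, (if x ⬝ᵥ x = t then (Fintype.card F : ℂ) else 0) * χ (-(ξ ⬝ᵥ x))) =
      (if ξ = 0 then 1 else 0) * (Fintype.card F : ℂ) ^ d +
      gaussSum (qchar F) χ ^ d *
        ∑ s : F, if s = 0 then 0 else qchar F s ^ d * χ (-t * s + (-((ξ ⬝ᵥ ξ) / 4)) / s) := by
  set g := gaussSum (qchar F) χ
  have hmap : ∀ (s : Finset (Fin d)) (h : Fin d → F), χ (∑ i ∈ s, h i) = ∏ i ∈ s, χ (h i) := by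
    intro s h
    induction s using Finset.induction_on with
    | empty => simp
    | insert a s ha ih => rw [Finset.sum_insert ha, Finset.prod_insert ha, AddChar.map_add_eq_mul, ih]
  have h1 : ∀ x : Fin d → F, (if x ⬝ᵥ x = t then (Fintype.card F : ℂ) else 0) =
      ∑ s : F, χ (s * (x ⬝ᵥ x - t)) := by
    intro x
    rw [AddChar.sum_mulShift _ (AddChar.IsPrimitive.of_ne_one hχ)]
    simp only [sub_eq_zero]
    split_ifs <;> simp
  simp_rw [h1, Finset.sum_mul]
  rw [Finset.sum_comm]
  have h3 : ∀ s : F, ∑ x : Fin d → F, χ (s * (x ⬝ᵥ x - t)) * χ (-(ξ ⬝ᵥ x)) =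
      χ (-t * s) * ∏ i : Fin d, ∑ y : F, χ (s * y ^ 2 - ξ i * y) := by
    intro s
    rw [Finset.prod_univ_sum, Fintype.piFinset_univ, Finset.mul_sum]
    refine Finset.sum_congr rfl fun x _ => ?_
    rw [← hmap, ← AddChar.map_add_eq_mul, ← AddChar.map_add_eq_mul]
    congr 1
    simp only [dotProduct, Finset.sum_sub_distrib, ← Finset.mul_sum, sq]
    ring
  simp_rw [h3]
  have h4 : ∀ s : F, χ (-t * s) * ∏ i : Fin d, ∑ y : F, χ (s * y ^ 2 - ξ i * y) =
      (if s = 0 then (if ξ = 0 then 1 else 0) * (Fintype.card F : ℂ) ^ d else 0) +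
      g ^ d * (if s = 0 then 0 else qchar F s ^ d * χ (-t * s + (-((ξ ⬝ᵥ ξ) / 4)) / s)) := by
    intro s
    by_cases hs : s = 0
    · subst hs
      have e1 : ∀ i, ∑ y : F, χ (0 * y ^ 2 - ξ i * y) =
          if ξ i = 0 then (Fintype.card F : ℂ) else 0 := by
        intro i
        have e2 : ∀ y : F, 0 * y ^ 2 - ξ i * y = y * (-(ξ i)) := fun y => by ring
        simp_rw [e2]
        rw [AddChar.sum_mulShift _ (AddChar.IsPrimitive.of_ne_one hχ)]
        simp only [neg_eq_zero]
        split_ifs <;> simp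
      simp_rw [e1]
      simp only [if_true, mul_zero, add_zero, AddChar.map_zero_eq_one, one_mul]
      by_cases hξ : ξ = 0
      · simp [hξ]
      · obtain ⟨i, hi⟩ := Function.ne_iff.1 hξ
        rw [if_neg hξ, zero_mul]
        exact Finset.prod_eq_zero (Finset.mem_univ i) (if_neg hi)
    · simp_rw [quad_sum h2 χ hχ hs]
      rw [Finset.prod_mul_distrib, ← hmap, Finset.prod_const, Finset.card_univ, Fintype.card_fin]
      simp only [if_neg hs, zero_add]
      have e3 : ∑ i, -(ξ i ^ 2 / 4 / s) = (-((ξ ⬝ᵥ ξ) / 4)) / s := by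
        simp only [dotProduct, Finset.sum_neg_distrib, ← Finset.sum_div, sq]
        ring
      rw [e3, AddChar.map_add_eq_mul]
      ring
  simp_rw [h4]
  rw [Finset.sum_add_distrib, ← Finset.mul_sum]
  simp



/-- Fourier decay for the sphere of nonzero radius: with `σ = q·1[|y|² = t]`,
`|σ̂(ξ) - δ(ξ)| ≤ 2 q^{(1-d)/2}`. -/
theorem sphere_fourier_decay {F : Type*} [Field F] [Fintype F]
    (hodd : ringChar F ≠ 2) (χ : AddChar F ℂ) (hχ : χ ≠ 1)
    (d : ℕ) (t : F) (ht : t ≠ 0) (ξ : Fin d → F) :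
    ‖(∑ x : Fin d → F,
          (if x ⬝ᵥ x = t then (Fintype.card F : ℂ) else 0) * χ (-(ξ ⬝ᵥ x))) /
            (Fintype.card F : ℂ) ^ d -
        (if ξ = 0 then 1 else 0)‖ ≤
      2 * (Fintype.card F : ℝ) ^ ((1 - (d : ℝ)) / 2) := by
  have hQ : (0 : ℝ) < Fintype.card F := by exact_mod_cast Fintype.card_pos
  have hQc : (Fintype.card F : ℂ) ^ d ≠ 0 := pow_ne_zero _ (by exact_mod_cast hQ.ne')
  rw [sphere_expand hodd χ hχ, add_div, mul_div_cancel_right₀ _ hQc, add_sub_cancel_left]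
  have hT := twisted_bound hodd χ hχ (neg_ne_zero.2 ht) (-((ξ ⬝ᵥ ξ) / 4)) d
  have hg := gauss_norm_sq hodd χ hχ
  rw [norm_div, norm_mul, norm_pow, norm_pow, Complex.norm_natCast]
  set T := ‖∑ s : F, if s = 0 then 0 else qchar F s ^ d * χ (-t * s + (-((ξ ⬝ᵥ ξ) / 4)) / s)‖
  set g := ‖gaussSum (qchar F) χ‖
  have hT0 : 0 ≤ T := norm_nonneg _
  have hg0 : 0 ≤ g := norm_nonneg _
  refine (pow_le_pow_iff_left₀ (by positivity) (by positivity) two_ne_zero).1 ?_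
  have h1 : (2 * (Fintype.card F : ℝ) ^ ((1 - (d : ℝ)) / 2)) ^ 2 =
      4 * Fintype.card F / (Fintype.card F : ℝ) ^ d := by
    rw [mul_pow, ← Real.rpow_natCast ((Fintype.card F : ℝ) ^ ((1 - (d : ℝ)) / 2)) 2,
      ← Real.rpow_mul hQ.le]
    have : (1 - (d : ℝ)) / 2 * ((2 : ℕ) : ℝ) = 1 - d := by push_cast; ring
    rw [this, Real.rpow_sub hQ, Real.rpow_one, Real.rpow_natCast]
    ring
  have h2 : (g ^ d * T / (Fintype.card F : ℝ) ^ d) ^ 2 = T ^ 2 / (Fintype.card F : ℝ) ^ d := by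
    rw [div_pow, mul_pow, ← pow_mul, mul_comm d 2, pow_mul, hg]
    field_simp
  rw [h1, h2]
  gcongr
end
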